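/- arXiv:math/0611547 — 2 statements merged into one kernel-verified Lean document; each statement's English description precedes it below -/
import Mathlib

section
/- For every k ∈ {1,…,6} and every irreducible complex character χ of G: if q ≡ 1 (mod 28) and χ(1) = (q+1)/2, or q ≡ 15 (mod 28) and χ(1) = (q−1)/2, then ⟨χ|_{H₇}, θ₇^k⟩ = (q−1)/14; if q ≡ 13 (mod 28) and χ(1) = (q+1)/2, or q ≡ 27 (mod 28) and χ(1) = (q−1)/2, then ⟨χ|_{H₇}, θ₇^k⟩ = (q+1)/14. -/
open scoped BigOperators Classical

noncomputable section

/-- The projective special linear group `PSL(2, F) = SL(2, F)/{±I}` (for `F` a finite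
field of odd characteristic the center of `SL(2,F)` is exactly `{±I}`). -/
abbrev PSL2 (F : Type) [Field F] : Type :=
  Matrix.SpecialLinearGroup (Fin 2) F ⧸ Subgroup.center (Matrix.SpecialLinearGroup (Fin 2) F)

/-- `χ` is the character of some finite-dimensional complex representation of `G`. -/
def IsCharacter (G : Type) [Group G] (χ : G → ℂ) : Prop :=
  ∃ V : FDRep ℂ G, V.character = χ

/-- `χ` is an irreducible complex character of `G`. -/
def IsIrrCharacter (G : Type) [Group G] (χ : G → ℂ) : Prop :=
  ∃ V : FDRep ℂ G, CategoryTheory.Simple V ∧ V.character = χ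

/-- `⟨χ|_H, θ⟩ = (1/|H|) ∑_{h ∈ H} χ(h) θ(h)⁻¹`, the multiplicity of the linear
character `θ` of `H` in the restriction `χ|_H`. -/
def restMult {G : Type} [Group G] [Finite G] (H : Subgroup G) (θ : H →* ℂˣ) (χ : G → ℂ) : ℂ :=
  letI : Fintype H := Fintype.ofFinite H
  (Nat.card H : ℂ)⁻¹ * ∑ h : H, χ h * ((θ h : ℂ))⁻¹

/-- `dim χ^H = (1/|H|) ∑_{h ∈ H} χ(h)`, the dimension of the `H`-fixed subspace. -/
def dimFixed {G : Type} [Group G] [Finite G] (H : Subgroup G) (χ : G → ℂ) : ℂ :=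
  letI : Fintype H := Fintype.ofFinite H
  (Nat.card H : ℂ)⁻¹ * ∑ h : H, χ h

/-- The ramification multiplicity
`Γ(χ) = (1/2)⟨χ|_{H₂},θ₂⟩ + (1/3)(⟨χ|_{H₃},θ₃⟩ + 2⟨χ|_{H₃},θ₃²⟩)
  + (1/7)∑_{k=1}^{6} k ⟨χ|_{H₇},θ₇^k⟩`. -/
def ramMult {G : Type} [Group G] [Finite G] (H2 H3 H7 : Subgroup G)
    (θ2 : H2 →* ℂˣ) (θ3 : H3 →* ℂˣ) (θ7 : H7 →* ℂˣ) (χ : G → ℂ) : ℂ :=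
  (1/2) * restMult H2 θ2 χ
    + (1/3) * (restMult H3 θ3 χ + 2 * restMult H3 (θ3 ^ 2) χ)
    + (1/7) * ∑ k ∈ Finset.Icc (1:ℕ) 6, (k : ℂ) * restMult H7 (θ7 ^ k) χ

/-- The base multiplicity `m = (q−ε₂)/4 + (q−ε₃)/3 + 3(q−ε₇)/7`, where
`ε_ℓ = 1` if `q ≡ 1 (mod ℓ')` and `ε_ℓ = −1` otherwise. -/
def baseMult (q : ℕ) : ℤ :=
  ((q : ℤ) - (if q % 4 = 1 then 1 else -1)) / 4
    + ((q : ℤ) - (if q % 3 = 1 then 1 else -1)) / 3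
    + 3 * (((q : ℤ) - (if q % 7 = 1 then 1 else -1)) / 7)

end


section Weights

variable {A : Type*} [AddCommGroup A] [Fintype A] {V : Type*} [AddCommGroup V] [Module ℂ V]

/-- The representation `σ ⊗ ψ⁻¹` of a commutative group. -/
noncomputable def twistRep (σ : Representation ℂ (Multiplicative A) V) (ψ : AddChar A ℂ) :
    Representation ℂ (Multiplicative A) V where
  toFun a := ψ (-a.toAdd) • σ a
  map_one' := by simp
  map_mul' a b := by
    simp only [toAdd_mul, neg_add, AddChar.map_add_eq_mul, map_mul, smul_mul_smul_comm]

/-- The multiplicity of the additive character `ψ` in the representation `σ`. -/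
noncomputable def weightMult (σ : Representation ℂ (Multiplicative A) V) (ψ : AddChar A ℂ) : ℕ :=
  Module.finrank ℂ (twistRep σ ψ).invariants

variable [FiniteDimensional ℂ V]

theorem card_mul_weightMult (σ : Representation ℂ (Multiplicative A) V) (ψ : AddChar A ℂ) :
    (Fintype.card A : ℂ) * weightMult σ ψ =
      ∑ a : A, ψ (-a) * σ.character (Multiplicative.ofAdd a) := by
  have hA : (Fintype.card A : ℂ) ≠ 0 := by simp
  have hA' : (Nat.card (Multiplicative A) : ℂ) = Fintype.card A := by
    rw [Nat.card_eq_fintype_card, Fintype.card_multiplicative]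
  have : Invertible (Nat.card (Multiplicative A) : ℂ) := invertibleOfNonzero (by rw [hA']; exact hA)
  have h := (twistRep σ ψ).card_inv_mul_sum_char_eq_finrank
  rw [weightMult, ← h, hA', mul_inv_cancel_left₀ hA]
  refine Fintype.sum_equiv Multiplicative.toAdd _ _ fun a => ?_
  simp [Representation.character, twistRep]

theorem character_eq_sum_weightMult (σ : Representation ℂ (Multiplicative A) V) (a : A) :
    σ.character (Multiplicative.ofAdd a) = ∑ ψ : AddChar A ℂ, weightMult σ ψ * ψ a := by
  have hA : (Fintype.card A : ℂ) ≠ 0 := by simp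
  apply mul_left_cancel₀ hA
  rw [Finset.mul_sum]
  simp_rw [← mul_assoc, card_mul_weightMult, Finset.sum_mul]
  rw [Finset.sum_comm]
  have : ∀ b : A, ∑ ψ : AddChar A ℂ, ψ (-b) * σ.character (Multiplicative.ofAdd b) * ψ a =
      σ.character (Multiplicative.ofAdd b) * if a = b then (Fintype.card A : ℂ) else 0 := by
    intro b
    have h := AddChar.sum_apply_eq_ite (a - b)
    simp only [sub_eq_zero] at h
    rw [← h, Finset.mul_sum]
    refine Finset.sum_congr rfl fun ψ _ => ?_
    rw [sub_eq_add_neg, AddChar.map_add_eq_mul]; ring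
  simp_rw [this]
  simp [mul_comm]

theorem finrank_eq_sum_weightMult (σ : Representation ℂ (Multiplicative A) V) :
    Module.finrank ℂ V = ∑ ψ : AddChar A ℂ, weightMult σ ψ := by
  have h := character_eq_sum_weightMult σ 0
  simp only [ofAdd_zero, Representation.char_one, AddChar.map_zero_eq_one, mul_one] at h
  exact_mod_cast h

theorem sum_character_mul_character_neg (σ : Representation ℂ (Multiplicative A) V) :
    ∑ a : A, σ.character (Multiplicative.ofAdd a) * σ.character (Multiplicative.ofAdd (-a)) =
      (Fintype.card A : ℂ) * ∑ ψ : AddChar A ℂ, (weightMult σ ψ : ℂ) ^ 2 := by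
  have h : ∀ a : A, σ.character (Multiplicative.ofAdd a) *
      σ.character (Multiplicative.ofAdd (-a)) = ∑ ψ : AddChar A ℂ,
        weightMult σ ψ * (ψ (-a) * σ.character (Multiplicative.ofAdd a)) := by
    intro a
    rw [character_eq_sum_weightMult σ (-a), Finset.mul_sum]
    exact Finset.sum_congr rfl fun ψ _ => by ring
  simp_rw [h]
  rw [Finset.sum_comm, Finset.mul_sum]
  refine Finset.sum_congr rfl fun ψ _ => ?_
  rw [← Finset.mul_sum, ← card_mul_weightMult]; ring

end Weights

section Matrices

open Matrix

variable {F : Type*} [Field F]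

/-- The upper unitriangular matrix with entry `x`. -/
def unipotentSL (x : F) : Matrix.SpecialLinearGroup (Fin 2) F := ⟨!![1, x; 0, 1], by simp⟩

/-- The upper triangular matrix with diagonal `a, a⁻¹` and entry `b`. -/
def borelSL (a : Fˣ) (b : F) : Matrix.SpecialLinearGroup (Fin 2) F :=
  ⟨!![(a : F), b; 0, ((a⁻¹ : Fˣ) : F)], by simp⟩

/-- A matrix with trace `t` and lower left entry `c`. -/
def companionSL (c : Fˣ) (t : F) : Matrix.SpecialLinearGroup (Fin 2) F :=
  ⟨!![0, -((c⁻¹ : Fˣ) : F); (c : F), t], by simp⟩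

/-- The matrix with nonzero lower left entry `c` and diagonal `a, d`. -/
def bigCellSL (c : Fˣ) (a d : F) : Matrix.SpecialLinearGroup (Fin 2) F :=
  ⟨!![a, (a * d - 1) * ((c⁻¹ : Fˣ) : F); (c : F), d], by simp⟩

theorem isConj_of_mul_eq {a b c : Matrix.SpecialLinearGroup (Fin 2) F}
    (h : (c : Matrix (Fin 2) (Fin 2) F) * (a : Matrix (Fin 2) (Fin 2) F) =
      (b : Matrix (Fin 2) (Fin 2) F) * (c : Matrix (Fin 2) (Fin 2) F)) : IsConj a b := by
  have h' : c * a = b * c := Subtype.ext h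
  exact isConj_iff.2 ⟨c, by rw [h', mul_inv_cancel_right]⟩

theorem eq_mul_of_coe {a b c : Matrix.SpecialLinearGroup (Fin 2) F}
    (h : (a : Matrix (Fin 2) (Fin 2) F) =
      (b : Matrix (Fin 2) (Fin 2) F) * (c : Matrix (Fin 2) (Fin 2) F)) : a = b * c :=
  Subtype.ext h

theorem eq_neg_of_coe {a b : Matrix.SpecialLinearGroup (Fin 2) F}
    (h : (a : Matrix (Fin 2) (Fin 2) F) = -(b : Matrix (Fin 2) (Fin 2) F)) : a = -b :=
  Subtype.ext h

theorem unipotentSL_zero : unipotentSL (0 : F) = 1 := by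
  ext i j; fin_cases i <;> fin_cases j <;> simp [unipotentSL]

theorem unipotentSL_add (x y : F) : unipotentSL (x + y) = unipotentSL x * unipotentSL y := by
  apply eq_mul_of_coe
  ext i j; fin_cases i <;> fin_cases j <;> simp [unipotentSL, mul_apply, add_comm]

theorem borelSL_mul (a b : Fˣ) : borelSL (a * b) 0 = borelSL a 0 * borelSL b 0 := by
  apply eq_mul_of_coe
  ext i j; fin_cases i <;> fin_cases j <;> simp [borelSL, mul_apply, mul_comm]

theorem borelSL_one (x : F) : borelSL 1 x = unipotentSL x := by
  ext i j; fin_cases i <;> fin_cases j <;> simp [unipotentSL, borelSL]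

theorem borelSL_neg_one (x : F) : borelSL (-1) x = - unipotentSL (-x) := by
  apply eq_neg_of_coe
  ext i j; fin_cases i <;> fin_cases j <;> simp [unipotentSL, borelSL]

theorem borelSL_mul_unipotentSL (a : Fˣ) (x : F) :
    borelSL a (a * x) = borelSL a 0 * unipotentSL x := by
  apply eq_mul_of_coe
  ext i j; fin_cases i <;> fin_cases j <;> simp [unipotentSL, borelSL, mul_apply]

theorem borelSL_mul_unipotentSL_eq (a : Fˣ) (x : F) :
    borelSL a 0 * unipotentSL x = unipotentSL ((a : F) ^ 2 * x) * borelSL a 0 := by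
  rw [← borelSL_mul_unipotentSL]
  apply eq_mul_of_coe
  ext i j; fin_cases i <;> fin_cases j <;> simp [unipotentSL, borelSL, mul_apply]
  field_simp

theorem isConj_unipotentSL (a : Fˣ) (x : F) :
    IsConj (unipotentSL x) (unipotentSL ((a : F) ^ 2 * x)) :=
  isConj_iff.2 ⟨borelSL a 0, by rw [borelSL_mul_unipotentSL_eq, mul_inv_cancel_right]⟩

theorem isConj_borelSL_zero (a : Fˣ) (b : F) (ha : (a : F) ^ 2 ≠ 1) :
    IsConj (borelSL a 0) (borelSL a b) := by
  have h : (a : F) ^ 2 - 1 ≠ 0 := sub_ne_zero.2 ha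
  refine isConj_of_mul_eq (c := unipotentSL (-(a * b) / ((a : F) ^ 2 - 1))) ?_
  ext i j; fin_cases i <;> fin_cases j <;> simp [unipotentSL, borelSL, mul_apply]
  field_simp; ring

theorem isConj_borelSL_inv (a : Fˣ) : IsConj (borelSL a 0) (borelSL a⁻¹ 0) := by
  refine isConj_of_mul_eq (c := companionSL 1 0) ?_
  ext i j; fin_cases i <;> fin_cases j <;> simp [companionSL, borelSL, mul_apply]

theorem isConj_bigCellSL (c : Fˣ) (a d : F) :
    IsConj (bigCellSL c a d) (companionSL c (a + d)) := by
  refine isConj_of_mul_eq (c := unipotentSL (-a * ((c⁻¹ : Fˣ) : F))) ?_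
  ext i j; fin_cases i <;> fin_cases j <;>
    simp [companionSL, unipotentSL, bigCellSL, mul_apply] <;> field_simp <;> ring

theorem isConj_borelSL_companionSL (a : Fˣ) (ha : (a : F) ^ 2 ≠ 1) :
    IsConj (borelSL a 0) (companionSL 1 ((a : F) + ((a⁻¹ : Fˣ) : F))) := by
  have h : (a : F) ^ 2 - 1 ≠ 0 := sub_ne_zero.2 ha
  refine isConj_of_mul_eq (c := ⟨!![-1 / ((a : F) ^ 2 - 1), -a; a / ((a : F) ^ 2 - 1), 1], ?_⟩) ?_
  · simp; field_simp; ring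
  · ext i j; fin_cases i <;> fin_cases j <;>
      simp [companionSL, borelSL, mul_apply] <;> field_simp <;> ring

theorem isConj_unipotentSL_companionSL (c : Fˣ) :
    IsConj (unipotentSL (-((c⁻¹ : Fˣ) : F))) (companionSL c 2) := by
  refine isConj_of_mul_eq (c := ⟨!![1, 0; -(c : F), 1], by simp⟩) ?_
  ext i j; fin_cases i <;> fin_cases j <;>
      simp [companionSL, unipotentSL, mul_apply] <;> ring

theorem companionSL_neg_two (c : Fˣ) : companionSL c (-2) = - companionSL (-c) 2 := by
  apply eq_neg_of_coe
  ext i j; fin_cases i <;> fin_cases j <;> simp [companionSL]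

theorem exists_quadraticForm_eq [Fintype F] (hF : (2 : F) ≠ 0) {t : F} (ht : t ^ 2 ≠ 4) (c : F) :
    ∃ x y : F, x ^ 2 + t * x * y + y ^ 2 = c := by
  have hodd : Fintype.card F % 2 = 1 := by
    apply FiniteField.odd_card_of_char_ne_two
    intro h
    exact hF (by have := ringChar.Nat.cast_ringChar (R := F); rw [h] at this; exact_mod_cast this)
  have h4 : (4 : F) ≠ 0 := by
    have : (4 : F) = 2 * 2 := by norm_num
    rw [this]; exact mul_ne_zero hF hF
  have hk : (1 - t ^ 2 / 4) ≠ 0 := by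
    intro h; apply ht; field_simp at h; linear_combination -h
  obtain ⟨a, b, hab⟩ := FiniteField.exists_root_sum_quadratic
    (f := (Polynomial.X ^ 2 - Polynomial.C c : Polynomial F))
    (g := Polynomial.C (1 - t ^ 2 / 4) * Polynomial.X ^ 2)
    (Polynomial.degree_X_pow_sub_C (by decide) _) (Polynomial.degree_C_mul_X_pow 2 hk) hodd
  refine ⟨a - t * b / 2, b, ?_⟩
  simp at hab
  field_simp
  field_simp at hab
  linear_combination hab

theorem isConj_companionSL [Fintype F] (hF : (2 : F) ≠ 0) {t : F} (ht : t ^ 2 ≠ 4) (c : Fˣ) :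
    IsConj (companionSL c t) (companionSL 1 t) := by
  obtain ⟨x, y, h⟩ := exists_quadraticForm_eq hF ht (c : F)
  have hc : (c : F) ≠ 0 := c.ne_zero
  refine isConj_of_mul_eq (c := ⟨!![x, -y * ((c⁻¹ : Fˣ) : F); y, (x + t * y) * ((c⁻¹ : Fˣ) : F)], ?_⟩) ?_
  · simp; field_simp; linear_combination h
  · ext i j; fin_cases i <;> fin_cases j <;>
      simp [companionSL, mul_apply] <;> field_simp <;> ring

theorem exists_eq_borelSL_or_bigCellSL (g : Matrix.SpecialLinearGroup (Fin 2) F) :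
    (∃ a b, g = borelSL a b) ∨ ∃ c a d, g = bigCellSL c a d := by
  have hdet := g.det_coe
  rw [det_fin_two] at hdet
  by_cases hc : g 1 0 = 0
  · left
    rw [hc, mul_zero, sub_zero] at hdet
    refine ⟨⟨g 0 0, g 1 1, hdet, by rw [mul_comm]; exact hdet⟩, g 0 1, ?_⟩
    ext i j; fin_cases i <;> fin_cases j <;> simp [borelSL, hc]
  · right
    refine ⟨Units.mk0 _ hc, g 0 0, g 1 1, ?_⟩
    ext i j; fin_cases i <;> fin_cases j <;> simp [bigCellSL]
    field_simp; linear_combination -hdet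

/-- The Bruhat decomposition of `SL(2, F)`. -/
noncomputable def bruhatEquiv :
    (Fˣ × F) ⊕ (Fˣ × F × F) ≃ Matrix.SpecialLinearGroup (Fin 2) F :=
  Equiv.ofBijective (Sum.elim (fun p => borelSL p.1 p.2) fun p => bigCellSL p.1 p.2.1 p.2.2) <| by
    constructor
    · have key : ∀ x y : Matrix.SpecialLinearGroup (Fin 2) F, x = y →
          x 0 0 = y 0 0 ∧ x 0 1 = y 0 1 ∧ x 1 0 = y 1 0 ∧ x 1 1 = y 1 1 := by
        rintro x _ rfl; simp
      rintro (⟨a, b⟩ | ⟨c, a, d⟩) (⟨a', b'⟩ | ⟨c', a', d'⟩) h <;> have h := key _ _ h <;>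
        simp only [Sum.elim_inl, Sum.elim_inr] at h <;> simp [borelSL, bigCellSL] at h ⊢
      · exact ⟨Units.ext h.1, h.2.1⟩
      · exact c'.ne_zero h.2.2.1.symm
      · exact ⟨Units.ext h.2.2.1, h.1, h.2.2.2⟩
    · intro g
      rcases exists_eq_borelSL_or_bigCellSL g with ⟨a, b, rfl⟩ | ⟨c, a, d, rfl⟩
      · exact ⟨Sum.inl (a, b), rfl⟩
      · exact ⟨Sum.inr (c, a, d), rfl⟩

end Matrices

section ClassSums

variable {F : Type*} [Field F] [Fintype F]

theorem sum_units_eq (f : F → ℂ) : ∑ c : Fˣ, f c = ∑ x, f x - f 0 := by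
  rw [← Finset.sum_erase_eq_sub (Finset.mem_univ _)]
  refine Finset.sum_bij (fun c _ => (c : F)) (by simp) (fun _ _ _ _ h => Units.ext h) ?_
    (fun _ _ => rfl)
  intro b hb
  exact ⟨Units.mk0 b (by simpa using hb), by simp⟩

theorem sum_borelSL (hF : (2 : F) ≠ 0) (f : Matrix.SpecialLinearGroup (Fin 2) F → ℂ)
    (hf : ∀ g h, IsConj g h → f g = f h) (hneg : ∀ g, f (-g) = f g) :
    ∑ a : Fˣ, ∑ b : F, f (borelSL a b) =
      Fintype.card F * (∑ a ∈ Finset.univ.filter fun a : Fˣ => (a : F) ^ 2 ≠ 1, f (companionSL 1 ((a : F) + ((a⁻¹ : Fˣ) : F)))) +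
      2 * ∑ x : F, f (unipotentSL x) := by
  rw [← Finset.sum_filter_add_sum_filter_not Finset.univ (fun a : Fˣ => (a : F) ^ 2 ≠ 1)]
  congr 1
  · rw [Finset.mul_sum]
    refine Finset.sum_congr rfl fun a ha => ?_
    have ha : (a : F) ^ 2 ≠ 1 := by simpa using ha
    rw [Finset.sum_congr rfl fun b _ => (hf _ _ (isConj_borelSL_zero a b ha)).symm,
      hf _ _ (isConj_borelSL_companionSL a ha)]
    simp
  · have hne : (1 : Fˣ) ≠ -1 := by
      intro h
      have := congrArg (Units.val) h
      simp only [Units.val_one, Units.val_neg] at this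
      apply hF; linear_combination this
    have hs : (Finset.univ.filter fun a : Fˣ => ¬ (a : F) ^ 2 ≠ 1) = {1, -1} := by
      ext a
      simp only [Finset.mem_filter, Finset.mem_univ, true_and, not_not, Finset.mem_insert,
        Finset.mem_singleton]
      rw [sq_eq_one_iff, Units.ext_iff, Units.ext_iff]; simp
    rw [hs, Finset.sum_pair hne]
    simp_rw [borelSL_one, borelSL_neg_one, hneg]
    rw [show ∑ x : F, f (unipotentSL (-x)) = ∑ x : F, f (unipotentSL x) from
      Equiv.sum_comp (Equiv.neg F) (fun x => f (unipotentSL x))]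
    ring

theorem sum_bigCellSL (hF : (2 : F) ≠ 0) (f : Matrix.SpecialLinearGroup (Fin 2) F → ℂ)
    (hf : ∀ g h, IsConj g h → f g = f h) (hneg : ∀ g, f (-g) = f g) :
    ∑ c : Fˣ, ∑ a : F, ∑ d : F, f (bigCellSL c a d) =
      Fintype.card F * ((Fintype.card F - 1) *
        (∑ t : F with t ^ 2 ≠ 4, f (companionSL 1 t)) +
      2 * (∑ x : F, f (unipotentSL x) - f 1)) := by
  have h1 : ∀ c : Fˣ, ∑ a : F, ∑ d : F, f (bigCellSL c a d) =
      Fintype.card F * ∑ t : F, f (companionSL c t) := by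
    intro c
    have : ∀ a : F, ∑ d : F, f (bigCellSL c a d) = ∑ t : F, f (companionSL c t) := by
      intro a
      rw [← Equiv.sum_comp (Equiv.addLeft a) (fun t => f (companionSL c t))]
      exact Finset.sum_congr rfl fun d _ => hf _ _ (isConj_bigCellSL c a d)
    simp [this]
  have h2 : (2 : F) ≠ -2 := by
    intro h
    have : (2 : F) * 2 = 0 := by linear_combination h
    simp [hF] at this
  have hs : (Finset.univ.filter fun t : F => ¬ t ^ 2 ≠ 4) = {2, -2} := by
    ext t
    have : (4 : F) = 2 ^ 2 := by norm_num
    simp [this, sq_eq_sq_iff_eq_or_eq_neg]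
    tauto
  have h3 : ∀ c : Fˣ, ∑ t : F, f (companionSL c t) =
      (∑ t : F with t ^ 2 ≠ 4, f (companionSL 1 t)) +
        (f (unipotentSL (-((c⁻¹ : Fˣ) : F))) + f (unipotentSL (((c⁻¹ : Fˣ) : F)))) := by
    intro c
    rw [← Finset.sum_filter_add_sum_filter_not Finset.univ (fun t : F => t ^ 2 ≠ 4), hs,
      Finset.sum_pair h2, companionSL_neg_two, hneg, ← hf _ _ (isConj_unipotentSL_companionSL c),
      ← hf _ _ (isConj_unipotentSL_companionSL (-c))]
    congr 1
    · refine Finset.sum_congr rfl fun t ht => hf _ _ (isConj_companionSL hF (by simpa using ht) c)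
    · simp
  have h4 : ∑ c : Fˣ, f (unipotentSL (((c⁻¹ : Fˣ) : F))) = ∑ x : F, f (unipotentSL x) - f 1 := by
    refine (Equiv.sum_comp (Equiv.inv Fˣ) (fun c : Fˣ => f (unipotentSL (c : F)))).trans ?_
    rw [sum_units_eq (fun x => f (unipotentSL x)), unipotentSL_zero]
  have h5 : ∑ c : Fˣ, f (unipotentSL (-((c⁻¹ : Fˣ) : F))) =
      ∑ x : F, f (unipotentSL x) - f 1 := by
    rw [← h4, ← Equiv.sum_comp (Equiv.neg Fˣ) (fun c : Fˣ => f (unipotentSL ((c⁻¹ : Fˣ) : F)))]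
    simp
  have h6 : (Fintype.card Fˣ : ℂ) = Fintype.card F - 1 := by
    rw [Fintype.card_units, Nat.cast_sub Fintype.card_pos, Nat.cast_one]
  simp_rw [h1, h3]
  rw [← Finset.mul_sum, Finset.sum_add_distrib, Finset.sum_add_distrib, h4, h5]
  simp only [Finset.sum_const, Finset.card_univ, nsmul_eq_mul, h6]
  ring

theorem sum_specialLinearGroup_eq (f : Matrix.SpecialLinearGroup (Fin 2) F → ℂ) :
    ∑ g, f g = ∑ a : Fˣ, ∑ b : F, f (borelSL a b) +
      ∑ c : Fˣ, ∑ a : F, ∑ d : F, f (bigCellSL c a d) := by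
  rw [← Equiv.sum_comp bruhatEquiv, Fintype.sum_sum_type, Fintype.sum_prod_type, Fintype.sum_prod_type]
  simp_rw [Fintype.sum_prod_type]
  rfl

/-- The sum of an even class function over `SL(2, F)`, expressed through its values on unipotent
elements and on the elements with lower left entry `1`. -/
theorem sum_classFunction (hF : (2 : F) ≠ 0) (f : Matrix.SpecialLinearGroup (Fin 2) F → ℂ)
    (hf : ∀ g h, IsConj g h → f g = f h) (hneg : ∀ g, f (-g) = f g) :
    ∑ g, f g = Fintype.card F *
        (∑ a ∈ Finset.univ.filter fun a : Fˣ => (a : F) ^ 2 ≠ 1, f (companionSL 1 ((a : F) + ((a⁻¹ : Fˣ) : F)))) +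
      2 * (∑ x : F, f (unipotentSL x)) + Fintype.card F * ((Fintype.card F - 1) *
        (∑ t : F with t ^ 2 ≠ 4, f (companionSL 1 t)) +
      2 * (∑ x : F, f (unipotentSL x) - f 1)) := by
  rw [sum_specialLinearGroup_eq, sum_borelSL hF f hf hneg, sum_bigCellSL hF f hf hneg]

theorem card_specialLinearGroup_fin_two :
    (Fintype.card (Matrix.SpecialLinearGroup (Fin 2) F) : ℂ) =
      Fintype.card F * ((Fintype.card F : ℂ) ^ 2 - 1) := by
  have h6 : (Fintype.card Fˣ : ℂ) = Fintype.card F - 1 := by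
    rw [Fintype.card_units, Nat.cast_sub Fintype.card_pos, Nat.cast_one]
  have h := sum_specialLinearGroup_eq (F := F) (fun _ => 1)
  simp only [Finset.sum_const, Finset.card_univ, nsmul_eq_mul, mul_one, h6] at h
  rw [h]; ring

end ClassSums

section NonsplitTorus

open Matrix

variable {F : Type*} [Field F] [Fintype F]

theorem FiniteField.exists_algebraMap_eq_of_pow_card_eq {K : Type*} [Field K] [Algebra F K] {y : K}
    (hy : y ^ Fintype.card F = y) : ∃ a : F, algebraMap F K a = y := by
  have h1 := Fintype.one_lt_card (α := F)
  have hne := FiniteField.X_pow_card_sub_X_ne_zero K h1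
  let S : Finset K := (Polynomial.X ^ Fintype.card F - Polynomial.X : Polynomial K).roots.toFinset
  have hsub : Finset.univ.image (algebraMap F K) ⊆ S := by
    intro x hx
    obtain ⟨a, -, rfl⟩ := Finset.mem_image.1 hx
    simp only [S, Multiset.mem_toFinset, Polynomial.mem_roots hne, Polynomial.IsRoot.def,
      Polynomial.eval_sub, Polynomial.eval_pow, Polynomial.eval_X]
    rw [← map_pow, FiniteField.pow_card, sub_self]
  have hcard : S.card ≤ (Finset.univ.image (algebraMap F K)).card := by
    rw [Finset.card_image_of_injective _ (algebraMap F K).injective, Finset.card_univ]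
    refine (Multiset.toFinset_card_le _).trans ((Polynomial.card_roots' _).trans ?_)
    rw [FiniteField.X_pow_card_sub_X_natDegree_eq K h1]
  have hyS : y ∈ S := by
    simp [S, Polynomial.mem_roots hne, hy]
  rw [← Finset.eq_of_subset_of_card_le hsub hcard] at hyS
  obtain ⟨a, -, ha⟩ := Finset.mem_image.1 hyS
  exact ⟨a, ha⟩

theorem companion_pow {K : Type*} [Field K] {b c : K} (h : b * c = 1) (i : ℕ) :
    (b - c) • (!![0, -1; 1, b + c] : Matrix (Fin 2) (Fin 2) K) ^ i =
      !![c * b ^ i * (-1) + b * c ^ i, -(b ^ i - c ^ i);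
        b ^ i - c ^ i, (b ^ i - c ^ i) * (b + c) - (c * b ^ i - b * c ^ i)] := by
  induction i with
  | zero =>
    ext i j; fin_cases i <;> fin_cases j <;> (simp; try ring)
  | succ i ih =>
    rw [pow_succ, ← smul_mul_assoc, ih]
    ext k l; fin_cases k <;> fin_cases l <;> simp [mul_apply, pow_succ] <;>
      first
      | linear_combination (b ^ i - c ^ i) * h
      | linear_combination (c ^ i - b ^ i) * h
      | ring

theorem add_inv_eq_iff {K : Type*} [Field K] {y z : K} (hy : y ≠ 0) (hz : z ≠ 0) :
    z + z⁻¹ = y + y⁻¹ ↔ z = y ∨ z = y⁻¹ := by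
  constructor
  · intro h
    field_simp at h
    have : (z - y) * (y * z - 1) = 0 := by linear_combination h
    rcases mul_eq_zero.1 this with h | h
    · left; linear_combination h
    · right; field_simp; linear_combination h
  · rintro (rfl | rfl)
    · rfl
    · simp [add_comm]

theorem add_inv_sq_eq_four_iff {K : Type*} [Field K] {y : K} (hy : y ≠ 0) :
    (y + y⁻¹) ^ 2 = 4 ↔ y ^ 2 = 1 := by
  have : (y + y⁻¹) ^ 2 - 4 = (y⁻¹ * (y ^ 2 - 1)) ^ 2 := by field_simp; ring
  rw [← sub_eq_zero, this, sq_eq_zero_iff, mul_eq_zero, sub_eq_zero]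
  simp [hy]

theorem exists_eq_add_inv {K : Type*} [Field K] (h2 : (2 : K) ≠ 0) {t s : K}
    (hs : t ^ 2 - 4 = s * s) : ∃ y : K, y ≠ 0 ∧ t = y + y⁻¹ := by
  have hy0 : (t + s) / 2 * ((t - s) / 2) = 1 := by
    field_simp; linear_combination hs
  refine ⟨(t + s) / 2, left_ne_zero_of_mul_eq_one hy0, ?_⟩
  rw [← eq_inv_of_mul_eq_one_right hy0]
  field_simp; ring

/-- The trace of an element of `SL(2, F)`. -/
def traceSL {F : Type*} [Field F] (g : Matrix.SpecialLinearGroup (Fin 2) F) : F := g 0 0 + g 1 1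

theorem map_companionSL_pow {F K : Type*} [Field F] [Field K] (φ : F →+* K) {τ : F} {b : K} (hb0 : b ≠ 0)
    (hτ : φ τ = b + b⁻¹) (i : ℕ) :
    (b - b⁻¹) * φ ((companionSL 1 τ ^ i) 0 0) = b * (b ^ i)⁻¹ - b⁻¹ * b ^ i ∧
    (b - b⁻¹) * φ ((companionSL 1 τ ^ i) 0 1) = -(b ^ i - (b ^ i)⁻¹) ∧
    (b - b⁻¹) * φ ((companionSL 1 τ ^ i) 1 0) = b ^ i - (b ^ i)⁻¹ ∧
    (b - b⁻¹) * φ ((companionSL 1 τ ^ i) 1 1) =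
      (b ^ i - (b ^ i)⁻¹) * (b + b⁻¹) - (b⁻¹ * b ^ i - b * (b ^ i)⁻¹) := by
  have h := companion_pow (mul_inv_cancel₀ hb0) i
  have h1 : (!![0, -1; 1, b + b⁻¹] : Matrix (Fin 2) (Fin 2) K) =
      φ.mapMatrix ((companionSL 1 τ : Matrix.SpecialLinearGroup (Fin 2) F) :
        Matrix (Fin 2) (Fin 2) F) := by
    ext k l; fin_cases k <;> fin_cases l <;> simp [companionSL, hτ]
  rw [h1, ← map_pow, ← Matrix.SpecialLinearGroup.coe_pow, inv_pow] at h
  have h00 := congrFun (congrFun h 0) 0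
  have h01 := congrFun (congrFun h 0) 1
  have h10 := congrFun (congrFun h 1) 0
  have h11 := congrFun (congrFun h 1) 1
  simp only [Matrix.smul_apply, RingHom.mapMatrix_apply, map_apply, of_apply, cons_val', cons_val_zero,
    cons_val_one, cons_val_fin_one, smul_eq_mul] at h00 h01 h10 h11
  exact ⟨h00.trans (by ring), h01, h10, h11⟩

/-- `g` generates a nonsplit torus of `SL(2, F)`, which is cyclic of order `2 * n`. -/
structure IsNonsplitGenerator (n : ℕ) (g : Matrix.SpecialLinearGroup (Fin 2) F) : Prop where
  pow_eq : g ^ n = -1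
  lower_left_ne_zero : ∀ i : ℕ, ¬ 2 * n ∣ 2 * i → (g ^ i) 1 0 ≠ 0
  traceSL_sq_ne : ∀ i : ℕ, ¬ 2 * n ∣ 2 * i → traceSL (g ^ i) ^ 2 ≠ 4
  card_add_card : ∀ t : F, t ^ 2 ≠ 4 →
    (Finset.univ.filter fun a : Fˣ => (a : F) + ((a⁻¹ : Fˣ) : F) = t).card +
    ((Finset.range (2 * n)).filter fun i => traceSL (g ^ i) = t).card = 2

theorem exists_isNonsplitGenerator_of_isAlgClosed (K : Type*) [Field K] [Algebra F K]
    [IsAlgClosed K] (hF : (2 : F) ≠ 0) {n : ℕ} (hn : Fintype.card F + 1 = 2 * n) :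
    ∃ g : Matrix.SpecialLinearGroup (Fin 2) F, IsNonsplitGenerator n g := by
  let φ : F →+* K := algebraMap F K
  have hφ : Function.Injective φ := φ.injective
  have hq0 : ((Fintype.card F : ℕ) : K) = 0 := by
    have := congrArg φ (FiniteField.cast_card_eq_zero F)
    rwa [map_natCast, map_zero] at this
  have hq1 := Fintype.one_lt_card (α := F)
  have : NeZero ((2 * n : ℕ) : K) := ⟨by rw [← hn]; push_cast; rw [hq0]; simp⟩
  have : NeZero (2 * n) := ⟨by omega⟩
  obtain ⟨b, hb⟩ := HasEnoughRootsOfUnity.exists_primitiveRoot K (2 * n)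
  have hb0 : b ≠ 0 := hb.ne_zero (by omega)
  have hbq : b ^ Fintype.card F = b⁻¹ := by
    rw [← mul_eq_one_iff_eq_inv₀ hb0, ← pow_succ, hn, hb.pow_eq_one]
  have frob_add : ∀ x y : K, (x + y) ^ Fintype.card F = x ^ Fintype.card F + y ^ Fintype.card F :=
    fun x y => map_add (FiniteField.frobeniusAlgHom F K) x y
  have frob : ∀ x : F, φ x ^ Fintype.card F = φ x := fun x => by
    rw [← map_pow, FiniteField.pow_card]
  obtain ⟨τ, hτ⟩ := FiniteField.exists_algebraMap_eq_of_pow_card_eq (F := F) (y := b + b⁻¹) (by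
    rw [frob_add, inv_pow, hbq, inv_inv, add_comm])
  have h2K : (2 : K) ≠ 0 := by
    intro h; apply hF; apply hφ; rw [map_ofNat, map_zero, h]
  have h4K : φ 4 = 4 := map_ofNat φ 4
  have hbi : ∀ i, b ^ i ≠ 0 := fun i => pow_ne_zero _ hb0
  have hsq : ∀ i, (b ^ i) ^ 2 = 1 → 2 * n ∣ 2 * i := fun i h => by
    rw [← pow_mul, mul_comm] at h
    exact hb.dvd_of_pow_eq_one _ h
  have hbc : b - b⁻¹ ≠ 0 := by
    intro h
    have h1 : b = b⁻¹ := sub_eq_zero.1 h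
    have h2 : (b ^ 1) ^ 2 = 1 := by
      rw [pow_one, sq]; nth_rw 2 [h1]; exact mul_inv_cancel₀ hb0
    have := Nat.le_of_dvd (by norm_num) (hsq 1 h2)
    omega
  have hg := map_companionSL_pow φ hb0 hτ
  set g : Matrix.SpecialLinearGroup (Fin 2) F := companionSL 1 τ
  have htr : ∀ i, φ (traceSL (g ^ i)) = b ^ i + (b ^ i)⁻¹ := by
    intro i
    obtain ⟨h00, -, -, h11⟩ := hg i
    apply mul_left_cancel₀ hbc
    rw [traceSL, map_add, mul_add, h00, h11]
    ring
  refine ⟨g, ?_, ?_, ?_, ?_⟩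
  · have hbn : b ^ n = -1 := by
      have h1 : (b ^ n) ^ 2 = 1 := by rw [← pow_mul, mul_comm, hb.pow_eq_one]
      refine (sq_eq_one_iff.1 h1).resolve_left fun h => ?_
      have := Nat.le_of_dvd (by omega) (hb.dvd_of_pow_eq_one _ h)
      omega
    obtain ⟨h00, h01, h10, h11⟩ := hg n
    rw [hbn] at h00 h01 h10 h11
    have e : ∀ x y : F, (b - b⁻¹) * φ x = (b - b⁻¹) * φ y → x = y := fun x y h =>
      hφ (mul_left_cancel₀ hbc h)
    apply eq_neg_of_coe
    ext k l; fin_cases k <;> fin_cases l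
    · exact e _ _ (h00.trans (by simp [inv_neg]; ring))
    · exact e _ _ (h01.trans (by simp [inv_neg]))
    · exact e _ _ (h10.trans (by simp [inv_neg]))
    · exact e _ _ (h11.trans (by simp [inv_neg]; ring))
  · intro i hi h
    obtain ⟨-, -, h10, -⟩ := hg i
    rw [h, map_zero, mul_zero] at h10
    apply hi; apply hsq
    rw [sq]; nth_rw 2 [sub_eq_zero.1 h10.symm]; exact mul_inv_cancel₀ (hbi i)
  · intro i hi h
    apply hi; apply hsq
    rw [← add_inv_sq_eq_four_iff (hbi i), ← htr, ← map_pow, h, h4K]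
  · intro t ht
    obtain ⟨s, hs⟩ := IsAlgClosed.exists_eq_mul_self (φ t ^ 2 - 4)
    obtain ⟨y, hy0, hyt⟩ := exists_eq_add_inv h2K hs
    have hy1 : y ^ 2 ≠ 1 := by
      intro h
      rw [← add_inv_sq_eq_four_iff hy0, ← hyt, ← map_pow, ← h4K] at h
      exact ht (hφ h)
    have hyinv : y ≠ y⁻¹ := fun h => hy1 (by
      rw [sq]; nth_rw 2 [h]; exact mul_inv_cancel₀ hy0)
    have hyq : y ^ Fintype.card F = y ∨ y ^ Fintype.card F = y⁻¹ := by
      rw [← add_inv_eq_iff hy0 (pow_ne_zero _ hy0), ← inv_pow, ← frob_add, ← hyt, frob]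
    have hunit : ∀ a : Fˣ, (a : F) + ((a⁻¹ : Fˣ) : F) = t ↔ φ a = y ∨ φ a = y⁻¹ := by
      intro a
      rw [← add_inv_eq_iff hy0 (by simp), ← hyt, ← map_inv₀, ← map_add, hφ.eq_iff,
        Units.val_inv_eq_inv_val]
    have hpow : ∀ i, traceSL (g ^ i) = t ↔ b ^ i = y ∨ b ^ i = y⁻¹ := by
      intro i
      rw [← add_inv_eq_iff hy0 (hbi i), ← hyt, ← htr, hφ.eq_iff]
    have hbiq : ∀ i, (b ^ i) ^ Fintype.card F = (b ^ i)⁻¹ := fun i => by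
      rw [← pow_mul, mul_comm, pow_mul, hbq, inv_pow]
    simp only [hunit, hpow]
    rcases hyq with hyq | hyq
    · obtain ⟨a, ha⟩ := FiniteField.exists_algebraMap_eq_of_pow_card_eq hyq
      have ha0 : a ≠ 0 := by rintro rfl; exact hy0 (by rw [← ha, map_zero])
      have h1 : (Finset.univ.filter fun c : Fˣ => φ c = y ∨ φ c = y⁻¹) =
          {Units.mk0 a ha0, (Units.mk0 a ha0)⁻¹} := by
        ext c
        simp only [Finset.mem_filter, Finset.mem_univ, true_and, Finset.mem_insert,
          Finset.mem_singleton, Units.ext_iff, Units.val_mk0, Units.val_inv_eq_inv_val]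
        rw [← ha, ← map_inv₀, hφ.eq_iff, hφ.eq_iff]
      have h2 : ((Finset.range (2 * n)).filter fun i => b ^ i = y ∨ b ^ i = y⁻¹) = ∅ := by
        rw [Finset.filter_eq_empty_iff]
        rintro i - (h | h)
        · have := hbiq i
          rw [h, hyq] at this
          exact hyinv this
        · have := hbiq i
          rw [h, inv_pow, hyq, inv_inv] at this
          exact hyinv this.symm
      rw [h1, h2, Finset.card_pair, Finset.card_empty]
      intro h
      have := congrArg (fun c : Fˣ => φ c) h
      simp only [Units.val_mk0, Units.val_inv_eq_inv_val, map_inv₀] at this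
      exact hyinv (by rw [← ha]; exact this)
    · obtain ⟨i, hi, rfl⟩ := hb.eq_pow_of_pow_eq_one (ξ := y) (by
        rw [← hn, pow_succ, hyq, inv_mul_cancel₀ hy0])
      have hi0 : i ≠ 0 := by rintro rfl; simp at hy1
      have hinv : (b ^ i)⁻¹ = b ^ (2 * n - i) := by
        rw [eq_comm, ← mul_eq_one_iff_eq_inv₀ hy0, ← pow_add, Nat.sub_add_cancel hi.le, hb.pow_eq_one]
      have h1 : (Finset.univ.filter fun c : Fˣ => φ c = b ^ i ∨ φ c = (b ^ i)⁻¹) = ∅ := by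
        rw [Finset.filter_eq_empty_iff]
        rintro c - (h | h)
        · have := frob c
          rw [h, hbiq] at this
          exact hyinv this.symm
        · have := frob c
          rw [h, inv_pow, hbiq, inv_inv] at this
          exact hyinv this
      have h2 : ((Finset.range (2 * n)).filter fun j => b ^ j = b ^ i ∨ b ^ j = (b ^ i)⁻¹) =
          {i, 2 * n - i} := by
        ext j
        simp only [Finset.mem_filter, Finset.mem_range, Finset.mem_insert, Finset.mem_singleton]
        constructor
        · rintro ⟨hj, h | h⟩
          · exact Or.inl (hb.pow_inj hj hi h)
          · rw [hinv] at h
            exact Or.inr (hb.pow_inj hj (by omega) h)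
        · rintro (rfl | rfl)
          · exact ⟨hi, Or.inl rfl⟩
          · exact ⟨by omega, Or.inr hinv.symm⟩
      rw [h1, h2, Finset.card_pair, Finset.card_empty]
      intro h
      exact hyinv (by rw [hinv, ← h])

theorem exists_isNonsplitGenerator (hF : (2 : F) ≠ 0) {n : ℕ} (hn : Fintype.card F + 1 = 2 * n) :
    ∃ g : Matrix.SpecialLinearGroup (Fin 2) F, IsNonsplitGenerator n g :=
  exists_isNonsplitGenerator_of_isAlgClosed (AlgebraicClosure F) hF hn

end NonsplitTorus

section TorusConjugacy

open Matrix

variable {F : Type*} [Field F]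

theorem isConj_companionSL_traceSL [Fintype F] (hF : (2 : F) ≠ 0)
    {x : Matrix.SpecialLinearGroup (Fin 2) F} (hx : x 1 0 ≠ 0) (ht : traceSL x ^ 2 ≠ 4) :
    IsConj x (companionSL 1 (traceSL x)) := by
  rcases exists_eq_borelSL_or_bigCellSL x with ⟨a, b, rfl⟩ | ⟨c, a, d, rfl⟩
  · simp [borelSL] at hx
  · have h : traceSL (bigCellSL c a d) = a + d := by simp [traceSL, bigCellSL]
    rw [h] at ht ⊢
    exact (isConj_bigCellSL c a d).trans (isConj_companionSL hF ht c)

theorem add_units_inv_sq_ne_four_iff (a : Fˣ) :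
    ((a : F) + ((a⁻¹ : Fˣ) : F)) ^ 2 ≠ 4 ↔ (a : F) ^ 2 ≠ 1 := by
  rw [Units.val_inv_eq_inv_val, Ne, add_inv_sq_eq_four_iff a.ne_zero]

theorem coe_sq (x : Matrix.SpecialLinearGroup (Fin 2) F) :
    (x : Matrix (Fin 2) (Fin 2) F) ^ 2 =
      traceSL x • (x : Matrix (Fin 2) (Fin 2) F) - 1 := by
  have h := x.det_coe
  rw [det_fin_two] at h
  rw [sq]
  ext i j; fin_cases i <;> fin_cases j <;> simp [mul_apply, traceSL]
  · linear_combination -h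
  · ring
  · ring
  · linear_combination -h

theorem eq_one_of_traceSL_eq_two {x : Matrix.SpecialLinearGroup (Fin 2) F} (ht : traceSL x = 2)
    {m : ℕ} (hm : (m : F) ≠ 0) (hx : x ^ m = 1) : x = 1 := by
  have hp : ∀ i : ℕ, (x : Matrix (Fin 2) (Fin 2) F) ^ i =
      (i : F) • ((x : Matrix (Fin 2) (Fin 2) F) - 1) + 1 := by
    intro i
    induction i with
    | zero => simp
    | succ i ih =>
      have h2 := coe_sq x
      rw [ht, sq] at h2
      rw [pow_succ, ih, add_mul, smul_mul_assoc, sub_mul, h2, one_mul]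
      push_cast
      module
  have h := hp m
  rw [← Matrix.SpecialLinearGroup.coe_pow, hx, Matrix.SpecialLinearGroup.coe_one,
    right_eq_add, smul_eq_zero] at h
  exact Subtype.ext (sub_eq_zero.1 (h.resolve_left hm))

theorem eq_one_or_eq_neg_one_of_pow_eq_one {x : Matrix.SpecialLinearGroup (Fin 2) F}
    (ht : traceSL x ^ 2 = 4) {m : ℕ} (hm : (m : F) ≠ 0) (hm2 : Even m) (hx : x ^ m = 1) :
    x = 1 ∨ x = -1 := by
  have h4 : (4 : F) = 2 ^ 2 := by norm_num
  rw [h4, sq_eq_sq_iff_eq_or_eq_neg] at ht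
  rcases ht with ht | ht
  · exact Or.inl (eq_one_of_traceSL_eq_two ht hm hx)
  · right
    have := eq_one_of_traceSL_eq_two (x := -x) (by
      rw [← neg_eq_iff_eq_neg.2 ht]; simp [traceSL]; ring) hm (by rw [hm2.neg_pow, hx])
    rw [← this, neg_neg]

namespace IsNonsplitGenerator

variable [Fintype F] {n : ℕ} {g : Matrix.SpecialLinearGroup (Fin 2) F}

theorem pow_two_mul_eq_one (hg : IsNonsplitGenerator n g) : g ^ (2 * n) = 1 := by
  rw [mul_comm, pow_mul, hg.pow_eq]; simp

theorem not_dvd_iff (hg : IsNonsplitGenerator n g) (i : ℕ) :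
    traceSL (g ^ i) ^ 2 ≠ 4 ↔ ¬ 2 * n ∣ 2 * i := by
  refine ⟨fun h hd => h ?_, hg.traceSL_sq_ne i⟩
  obtain ⟨k, rfl⟩ := (Nat.mul_dvd_mul_iff_left (by norm_num)).1 hd
  rw [pow_mul, hg.pow_eq]
  rcases neg_one_pow_eq_or (Matrix.SpecialLinearGroup (Fin 2) F) k with h | h <;> rw [h] <;>
    simp [traceSL] <;> norm_num

theorem isConj_pow (hg : IsNonsplitGenerator n g) (hF : (2 : F) ≠ 0) {i : ℕ}
    (hi : ¬ 2 * n ∣ 2 * i) : IsConj (g ^ i) (companionSL 1 (traceSL (g ^ i))) :=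
  isConj_companionSL_traceSL hF (hg.lower_left_ne_zero i hi) (hg.traceSL_sq_ne i hi)

theorem two_mul_sum (hg : IsNonsplitGenerator n g) (f : F → ℂ) :
    2 * ∑ t ∈ Finset.univ.filter fun t : F => t ^ 2 ≠ 4, f t =
      ∑ a ∈ Finset.univ.filter fun a : Fˣ => (a : F) ^ 2 ≠ 1, f ((a : F) + ((a⁻¹ : Fˣ) : F)) +
      ∑ i ∈ (Finset.range (2 * n)).filter fun i => ¬ 2 * n ∣ 2 * i, f (traceSL (g ^ i)) := by
  have e1 := Finset.sum_fiberwise_of_maps_to (s := Finset.univ.filter fun a : Fˣ => (a : F) ^ 2 ≠ 1)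
    (t := Finset.univ.filter fun t : F => t ^ 2 ≠ 4)
    (g := fun a : Fˣ => (a : F) + ((a⁻¹ : Fˣ) : F))
    (fun a ha => by simpa using (add_units_inv_sq_ne_four_iff a).2 (Finset.mem_filter.1 ha).2)
    (fun a : Fˣ => f ((a : F) + ((a⁻¹ : Fˣ) : F)))
  have e2 := Finset.sum_fiberwise_of_maps_to
    (s := (Finset.range (2 * n)).filter fun i => ¬ 2 * n ∣ 2 * i)
    (t := Finset.univ.filter fun t : F => t ^ 2 ≠ 4) (g := fun i => traceSL (g ^ i))
    (fun i hi => by simpa using (hg.not_dvd_iff i).2 (Finset.mem_filter.1 hi).2)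
    (fun i => f (traceSL (g ^ i)))
  rw [← e1, ← e2, ← Finset.sum_add_distrib, Finset.mul_sum]
  refine Finset.sum_congr rfl fun t ht => ?_
  have ht : t ^ 2 ≠ 4 := by simpa using ht
  have h1 : ((Finset.univ.filter fun a : Fˣ => (a : F) ^ 2 ≠ 1).filter
      fun a : Fˣ => (a : F) + ((a⁻¹ : Fˣ) : F) = t) =
      Finset.univ.filter fun a : Fˣ => (a : F) + ((a⁻¹ : Fˣ) : F) = t := by
    ext a
    simp only [Finset.mem_filter, Finset.mem_univ, true_and, and_iff_right_iff_imp]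
    rintro rfl
    exact (add_units_inv_sq_ne_four_iff a).1 ht
  have h2 : (((Finset.range (2 * n)).filter fun i => ¬ 2 * n ∣ 2 * i).filter
      fun i => traceSL (g ^ i) = t) =
      (Finset.range (2 * n)).filter fun i => traceSL (g ^ i) = t := by
    ext i
    simp only [Finset.mem_filter]
    constructor
    · rintro ⟨⟨h, -⟩, h'⟩; exact ⟨h, h'⟩
    · rintro ⟨h, rfl⟩; exact ⟨⟨h, (hg.not_dvd_iff i).1 ht⟩, rfl⟩
  rw [h1, h2, Finset.sum_congr rfl (g := fun _ => f t), Finset.sum_const,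
    Finset.sum_congr rfl (g := fun _ => f t), Finset.sum_const, ← add_smul, hg.card_add_card t ht,
    two_smul, two_mul]
  · intro i hi; rw [(Finset.mem_filter.1 hi).2]
  · intro i hi; rw [(Finset.mem_filter.1 hi).2]

theorem isConj_borelSL_or_isConj_pow (hg : IsNonsplitGenerator n g) (hF : (2 : F) ≠ 0)
    {x : Matrix.SpecialLinearGroup (Fin 2) F} (ht : traceSL x ^ 2 ≠ 4) :
    (∃ a : Fˣ, (a : F) ^ 2 ≠ 1 ∧ IsConj x (borelSL a 0)) ∨
      ∃ i, ¬ 2 * n ∣ 2 * i ∧ IsConj x (g ^ i) := by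
  by_cases hx : x 1 0 = 0
  · rcases exists_eq_borelSL_or_bigCellSL x with ⟨a, b, rfl⟩ | ⟨c, a, d, rfl⟩
    · have h : traceSL (borelSL a b) = (a : F) + ((a⁻¹ : Fˣ) : F) := by simp [traceSL, borelSL]
      rw [h, add_units_inv_sq_ne_four_iff] at ht
      exact Or.inl ⟨a, ht, (isConj_borelSL_zero a b ht).symm⟩
    · simp [bigCellSL] at hx
  · have hc := isConj_companionSL_traceSL hF hx ht
    have h2 := hg.card_add_card _ ht
    by_cases h0 : (Finset.univ.filter fun a : Fˣ =>
        (a : F) + ((a⁻¹ : Fˣ) : F) = traceSL x).Nonempty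
    · obtain ⟨a, ha⟩ := h0
      have ha := (Finset.mem_filter.1 ha).2
      rw [← ha] at hc ht
      rw [add_units_inv_sq_ne_four_iff] at ht
      exact Or.inl ⟨a, ht, hc.trans (isConj_borelSL_companionSL a ht).symm⟩
    · rw [Finset.not_nonempty_iff_eq_empty] at h0
      rw [h0, Finset.card_empty, zero_add] at h2
      obtain ⟨i, hi⟩ := Finset.card_pos.1 (h2.symm ▸ two_pos)
      have hi := (Finset.mem_filter.1 hi).2
      rw [← hi] at hc ht
      have hd := (hg.not_dvd_iff i).1 ht
      exact Or.inr ⟨i, hd, hc.trans (hg.isConj_pow hF hd).symm⟩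

theorem sum_classFunction (hg : IsNonsplitGenerator n g) (hF : (2 : F) ≠ 0)
    (f : Matrix.SpecialLinearGroup (Fin 2) F → ℂ)
    (hf : ∀ g h, IsConj g h → f g = f h) (hneg : ∀ g, f (-g) = f g) :
    2 * ∑ x, f x = Fintype.card F * (Fintype.card F + 1) *
        (∑ a ∈ Finset.univ.filter fun a : Fˣ => (a : F) ^ 2 ≠ 1, f (borelSL a 0)) +
      4 * (Fintype.card F + 1) * (∑ x : F, f (unipotentSL x)) - 4 * Fintype.card F * f 1 +
      Fintype.card F * (Fintype.card F - 1) *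
        ∑ i ∈ (Finset.range (2 * n)).filter fun i => ¬ 2 * n ∣ 2 * i, f (g ^ i) := by
  have h := hg.two_mul_sum fun t => f (companionSL 1 t)
  have h1 : ∑ a ∈ Finset.univ.filter fun a : Fˣ => (a : F) ^ 2 ≠ 1, f (borelSL a 0) =
      ∑ a ∈ Finset.univ.filter fun a : Fˣ => (a : F) ^ 2 ≠ 1,
        f (companionSL 1 ((a : F) + ((a⁻¹ : Fˣ) : F))) :=
    Finset.sum_congr rfl fun a ha => hf _ _ (isConj_borelSL_companionSL a (by simpa using ha))
  have h2 : ∑ i ∈ (Finset.range (2 * n)).filter fun i => ¬ 2 * n ∣ 2 * i, f (g ^ i) =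
      ∑ i ∈ (Finset.range (2 * n)).filter fun i => ¬ 2 * n ∣ 2 * i,
        f (companionSL 1 (traceSL (g ^ i))) :=
    Finset.sum_congr rfl fun i hi => hf _ _ (hg.isConj_pow hF (Finset.mem_filter.1 hi).2)
  rw [_root_.sum_classFunction hF f hf hneg, h1, h2]
  linear_combination (Fintype.card F : ℂ) * (Fintype.card F - 1) * h

end IsNonsplitGenerator

end TorusConjugacy

section UnipotentRestriction

variable {F : Type*} [Field F]

theorem sum_eq_of_sq_mul_invariant [Fintype F] (hF : ringChar F ≠ 2) {ν : F} (hν : ¬ IsSquare ν)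
    (h : F → ℂ) (hh : ∀ (a : Fˣ) (b : F), h ((a : F) ^ 2 * b) = h b) :
    2 * ∑ b, h b = 2 * h 0 + (Fintype.card F - 1) * (h 1 + h ν) := by
  have hν0 : ν ≠ 0 := by rintro rfl; exact hν (IsSquare.zero)
  have h1 : ∀ b : F, b ≠ 0 → 2 * h b = h 1 + h ν + (quadraticChar F b : ℂ) * (h 1 - h ν) := by
    intro b hb
    by_cases hs : IsSquare b
    · rw [(quadraticChar_one_iff_isSquare hb).2 hs]
      obtain ⟨a, rfl⟩ := hs
      have ha : a ≠ 0 := left_ne_zero_of_mul hb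
      have := hh (Units.mk0 a ha) 1
      rw [Units.val_mk0, mul_one, sq] at this
      rw [this]; push_cast; ring
    · rw [quadraticChar_neg_one_iff_not_isSquare.2 hs]
      have hs2 : IsSquare (b * ν⁻¹) := by
        rw [← quadraticChar_one_iff_isSquare (mul_ne_zero hb (inv_ne_zero hν0)), map_mul,
          quadraticChar_neg_one_iff_not_isSquare.2 hs, quadraticChar_neg_one_iff_not_isSquare.2]
        · norm_num
        · rwa [isSquare_inv]
      obtain ⟨a, ha⟩ := hs2
      have hb' : b = a ^ 2 * ν := by rw [sq, ← ha]; field_simp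
      have ha0 : a ≠ 0 := by rintro rfl; apply hb; rw [hb']; ring
      have := hh (Units.mk0 a ha0) ν
      rw [Units.val_mk0, ← hb'] at this
      rw [this]; push_cast; ring
  have h2 : ∑ b ∈ Finset.univ.erase (0 : F), (quadraticChar F b : ℂ) = 0 := by
    have := quadraticChar_sum_zero hF
    rw [← Finset.add_sum_erase _ _ (Finset.mem_univ (0 : F)), MulChar.map_zero, zero_add] at this
    exact_mod_cast this
  rw [← Finset.add_sum_erase _ _ (Finset.mem_univ (0 : F)), mul_add, Finset.mul_sum,
    Finset.sum_congr rfl fun b hb => h1 b (Finset.ne_of_mem_erase hb), Finset.sum_add_distrib,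
    ← Finset.sum_mul, h2, Finset.sum_const, Finset.card_erase_of_mem (Finset.mem_univ _),
    Finset.card_univ, nsmul_eq_mul, Nat.cast_sub Fintype.card_pos]
  push_cast; ring

/-- The upper unitriangular one-parameter subgroup of `SL(2, F)`. -/
def unipotentHom (F : Type*) [Field F] : Multiplicative F →* Matrix.SpecialLinearGroup (Fin 2) F where
  toFun x := unipotentSL x.toAdd
  map_one' := unipotentSL_zero
  map_mul' _ _ := unipotentSL_add _ _

variable [Fintype F] {V : Type*} [AddCommGroup V] [Module ℂ V] [FiniteDimensional ℂ V]

theorem weightMult_mulShift (ρ : Representation ℂ (Matrix.SpecialLinearGroup (Fin 2) F) V)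
    (ψ : AddChar F ℂ) (a : Fˣ) :
    weightMult (ρ.comp (unipotentHom F)) (ψ.mulShift ((a : F) ^ 2)) =
      weightMult (ρ.comp (unipotentHom F)) ψ := by
  have hc : (Fintype.card F : ℂ) ≠ 0 := by simp
  have h : (Fintype.card F : ℂ) * weightMult (ρ.comp (unipotentHom F)) (ψ.mulShift ((a : F) ^ 2)) =
      Fintype.card F * weightMult (ρ.comp (unipotentHom F)) ψ := by
    rw [card_mul_weightMult, card_mul_weightMult]
    refine Fintype.sum_equiv (Units.mulLeft (a ^ 2)) _ _ fun x => ?_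
    have : ρ.character (unipotentSL x) = ρ.character (unipotentSL ((a : F) ^ 2 * x)) := by
      obtain ⟨c, hc⟩ := isConj_iff.1 (isConj_unipotentSL a x)
      rw [← hc, Representation.char_conj]
    simp [AddChar.mulShift_apply]
    left
    exact this
  exact_mod_cast mul_left_cancel₀ hc h

theorem two_mul_sum_addChar (hF : ringChar F ≠ 2) :
    ∃ ψ₁ ψ₂ : AddChar F ℂ, ∀ h : AddChar F ℂ → ℂ,
      (∀ (ψ : AddChar F ℂ) (a : Fˣ), h (ψ.mulShift ((a : F) ^ 2)) = h ψ) →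
      2 * ∑ ψ, h ψ = 2 * h 1 + (Fintype.card F - 1) * (h ψ₁ + h ψ₂) := by
  obtain ⟨ν, hν⟩ := FiniteField.exists_nonsquare hF
  obtain ⟨ψ, hψ⟩ : ∃ ψ : AddChar F ℂ, ψ ≠ 1 := by
    have : Nontrivial (AddChar F ℂ) := by
      rw [← Fintype.one_lt_card_iff_nontrivial, AddChar.card_eq]
      exact Fintype.one_lt_card
    exact exists_ne 1
  have hprim := AddChar.IsPrimitive.of_ne_one hψ
  have hbij : Function.Bijective fun b : F => ψ.mulShift b :=
    (Fintype.bijective_iff_injective_and_card _).2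
      ⟨AddChar.to_mulShift_inj_of_isPrimitive hprim, AddChar.card_eq.symm⟩
  refine ⟨ψ.mulShift 1, ψ.mulShift ν, fun h hh => ?_⟩
  have := sum_eq_of_sq_mul_invariant hF hν (fun b => h (ψ.mulShift b)) fun a b => by
    rw [mul_comm]
    have := hh (ψ.mulShift b) a
    rwa [AddChar.mulShift_mulShift] at this
  rw [← hbij.sum_comp h, this, AddChar.mulShift_zero]

end UnipotentRestriction

section HalfDegree

variable {F : Type*} [Field F]

theorem MonoidHom.eq_one_of_unipotentSL {M : Type*} [Monoid M]
    (φ : Matrix.SpecialLinearGroup (Fin 2) F →* M) (h : ∀ x, φ (unipotentSL x) = 1) (g) :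
    φ g = 1 := by
  have hl : ∀ c : Fˣ, φ (bigCellSL c 1 1) = 1 := by
    intro c
    have hc : IsConj (unipotentSL (-(c : F))) (bigCellSL c 1 1) := by
      refine isConj_of_mul_eq (c := companionSL 1 0) ?_
      ext i j; fin_cases i <;> fin_cases j <;>
        simp [companionSL, unipotentSL, bigCellSL, Matrix.mul_apply]
    obtain ⟨w, hw⟩ := isConj_iff.1 hc
    rw [← hw, map_mul, map_mul, h, mul_one, ← map_mul, mul_inv_cancel, map_one]
  have hb : ∀ (c : Fˣ) (a d : F), φ (bigCellSL c a d) = 1 := by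
    intro c a d
    have h1 : bigCellSL c a d = unipotentSL ((a - 1) * ((c⁻¹ : Fˣ) : F)) * bigCellSL c 1 d := by
      apply eq_mul_of_coe
      ext i j; fin_cases i <;> fin_cases j <;>
        simp [unipotentSL, bigCellSL, Matrix.mul_apply] <;> field_simp <;> ring
    have h2 : bigCellSL c 1 d = bigCellSL c 1 1 * unipotentSL ((d - 1) * ((c⁻¹ : Fˣ) : F)) := by
      apply eq_mul_of_coe
      ext i j; fin_cases i <;> fin_cases j <;>
        simp [unipotentSL, bigCellSL, Matrix.mul_apply] <;> field_simp <;> ring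
    rw [h1, h2, map_mul, map_mul, h, h, hl, one_mul, one_mul]
  rcases exists_eq_borelSL_or_bigCellSL g with ⟨a, b, rfl⟩ | ⟨c, a, d, rfl⟩
  · have h1 : bigCellSL a (a : F) (b + ((a⁻¹ : Fˣ) : F)) = bigCellSL 1 1 1 * borelSL a b := by
      apply eq_mul_of_coe
      ext i j; fin_cases i <;> fin_cases j <;>
        simp [borelSL, bigCellSL, Matrix.mul_apply]
      field_simp; ring
    have h2 := congrArg φ h1
    rw [map_mul, hb, hb, one_mul] at h2
    exact h2.symm
  · exact hb c a d

variable [Fintype F] {V : Type*} [AddCommGroup V] [Module ℂ V]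

/-- `ρ` is an irreducible representation of `SL(2, F)`, trivial on `-1`, of degree `(q - 1) / 2` if
`ε = 0` and `(q + 1) / 2` if `ε = 1`; irreducibility is expressed through the norm of the
character. -/
structure IsHalfDegree (ρ : Representation ℂ (Matrix.SpecialLinearGroup (Fin 2) F) V) (ε : ℕ) :
    Prop where
  map_neg_one : ρ (-1) = 1
  sum_character : ∑ g, ρ.character g * ρ.character g⁻¹ =
    (Fintype.card (Matrix.SpecialLinearGroup (Fin 2) F) : ℂ)
  two_mul_finrank : 2 * Module.finrank ℂ V + 1 = Fintype.card F + 2 * ε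
  le_one : ε ≤ 1

namespace IsHalfDegree

variable [FiniteDimensional ℂ V] {ρ : Representation ℂ (Matrix.SpecialLinearGroup (Fin 2) F) V}
  {ε : ℕ}

omit [Fintype F] [FiniteDimensional ℂ V] in
theorem _root_.Representation.character_eq_of_isConj {x y : Matrix.SpecialLinearGroup (Fin 2) F}
    (h : IsConj x y) : ρ.character x = ρ.character y := by
  obtain ⟨c, hc⟩ := isConj_iff.1 h
  rw [← hc, Representation.char_conj]

theorem weightMult_one_and_sum_sq (h : IsHalfDegree ρ ε) (h5 : 5 < Fintype.card F) :
    weightMult (ρ.comp (unipotentHom F)) 1 = ε ∧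
      ∑ ψ, (weightMult (ρ.comp (unipotentHom F)) ψ : ℂ) ^ 2 = Module.finrank ℂ V := by
  have hd := h.two_mul_finrank
  have hε := h.le_one
  have hodd : ringChar F ≠ 2 := by
    intro h2
    have := FiniteField.even_card_iff_char_two.1 h2
    omega
  obtain ⟨ψ₁, ψ₂, key⟩ := two_mul_sum_addChar hodd
  set m := weightMult (ρ.comp (unipotentHom F)) with hm
  have h1 := key (fun ψ => (m ψ : ℂ)) fun ψ a => by rw [hm, weightMult_mulShift]
  have h2 := key (fun ψ => (m ψ : ℂ) ^ 2) fun ψ a => by rw [hm, weightMult_mulShift]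
  have h3 : Module.finrank ℂ V = ∑ ψ, m ψ := finrank_eq_sum_weightMult (ρ.comp (unipotentHom F))
  rw [← Nat.cast_sum, ← h3] at h1
  have h1' : 2 * (Module.finrank ℂ V : ℤ) = 2 * m 1 + (Fintype.card F - 1) * (m ψ₁ + m ψ₂) := by
    exact_mod_cast h1
  have hd' : 2 * (Module.finrank ℂ V : ℤ) + 1 = Fintype.card F + 2 * ε := by exact_mod_cast hd
  have hne : m ψ₁ + m ψ₂ ≠ 0 := by
    intro h0
    have h0' : (m ψ₁ + m ψ₂ : ℤ) = 0 := by exact_mod_cast h0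
    rw [h0', mul_zero, add_zero] at h1'
    have hm1 : m 1 = Module.finrank ℂ V := by omega
    have htop : (twistRep (ρ.comp (unipotentHom F)) 1).invariants = ⊤ :=
      Submodule.eq_top_of_finrank_eq hm1
    have hu : ∀ x, ρ (unipotentSL x) = 1 := by
      intro x
      ext v
      have hv : v ∈ (twistRep (ρ.comp (unipotentHom F)) 1).invariants := htop ▸ Submodule.mem_top
      have := hv (Multiplicative.ofAdd x)
      simpa [twistRep, unipotentHom] using this
    have hall := MonoidHom.eq_one_of_unipotentSL ρ hu
    have hs := h.sum_character
    simp only [Representation.character, hall, Module.End.one_eq_id, LinearMap.trace_id,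
      Finset.sum_const, Finset.card_univ, nsmul_eq_mul] at hs
    have hc : (Fintype.card (Matrix.SpecialLinearGroup (Fin 2) F) : ℂ) ≠ 0 := by simp
    have := mul_right_eq_self₀.1 hs
    have hdd : Module.finrank ℂ V * Module.finrank ℂ V = 1 := by
      exact_mod_cast this.resolve_right hc
    have := Nat.eq_one_of_mul_eq_one_right hdd
    omega
  have hone : m ψ₁ + m ψ₂ = 1 := by
    by_contra hn
    have : (2 : ℤ) ≤ m ψ₁ + m ψ₂ := by exact_mod_cast (by omega : 2 ≤ m ψ₁ + m ψ₂)
    have hc : (5 : ℤ) < Fintype.card F := by exact_mod_cast h5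
    have : (ε : ℤ) ≤ 1 := by exact_mod_cast hε
    nlinarith
  have hone' : (m ψ₁ + m ψ₂ : ℤ) = 1 := by exact_mod_cast hone
  rw [hone', mul_one] at h1'
  have hm1 : m 1 = ε := by omega
  refine ⟨hm1, ?_⟩
  have hsq : (m ψ₁ : ℂ) ^ 2 + (m ψ₂ : ℂ) ^ 2 = 1 := by
    rcases (by omega : (m ψ₁ = 0 ∧ m ψ₂ = 1) ∨ (m ψ₁ = 1 ∧ m ψ₂ = 0)) with ⟨h, h'⟩ | ⟨h, h'⟩ <;>
      rw [h, h'] <;> norm_num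
  have hεsq : (ε : ℂ) ^ 2 = ε := by
    rcases (by omega : ε = 0 ∨ ε = 1) with h | h <;> rw [h] <;> norm_num
  have hd'' : 2 * (Module.finrank ℂ V : ℂ) + 1 = Fintype.card F + 2 * ε := by exact_mod_cast hd
  simp only [hsq, hm1, hεsq] at h2
  linear_combination (h2 - hd'') / 2

theorem sum_unipotent (h : IsHalfDegree ρ ε) (h5 : 5 < Fintype.card F) :
    ∑ x : F, ρ.character (unipotentSL x) * ρ.character (unipotentSL x)⁻¹ =
      Fintype.card F * Module.finrank ℂ V := by
  rw [← (h.weightMult_one_and_sum_sq h5).2, ← sum_character_mul_character_neg]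
  refine Finset.sum_congr rfl fun x _ => ?_
  congr 2
  exact (map_inv (unipotentHom F) (Multiplicative.ofAdd x)).symm

omit [FiniteDimensional ℂ V] in
theorem apply_neg (h : IsHalfDegree ρ ε) (x : Matrix.SpecialLinearGroup (Fin 2) F) :
    ρ (-x) = ρ x := by
  rw [← neg_one_mul, map_mul, h.map_neg_one, one_mul]

theorem exists_split_character (h : IsHalfDegree ρ ε) (h5 : 5 < Fintype.card F) :
    ∃ l : Fˣ →* ℂ, l (-1) = 1 ∧ ∀ a : Fˣ, (a : F) ^ 2 ≠ 1 → ρ.character (borelSL a 0) = ε * l a := by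
  have hm := (h.weightMult_one_and_sum_sq h5).1
  have hε := h.le_one
  have hq : (Fintype.card F : ℂ) ≠ 0 := by simp
  let P : V →ₗ[ℂ] V := ∑ x : F, ρ (unipotentSL x)
  have htr : ∀ a : Fˣ, (a : F) ^ 2 ≠ 1 →
      (Fintype.card F : ℂ) * ρ.character (borelSL a 0) = LinearMap.trace ℂ V (ρ (borelSL a 0) * P) := by
    intro a ha
    have : ∀ x : F, LinearMap.trace ℂ V (ρ (borelSL a 0) * ρ (unipotentSL x)) =
        ρ.character (borelSL a 0) := by
      intro x
      rw [← map_mul, ← borelSL_mul_unipotentSL]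
      exact (Representation.character_eq_of_isConj (isConj_borelSL_zero a _ ha)).symm
    simp [P, Finset.mul_sum, this]
  have hP : ∀ v x, ρ (unipotentSL x) (P v) = P v := by
    intro v x
    have : ρ (unipotentSL x) * P = P := by
      simp only [P, Finset.mul_sum, ← map_mul, ← unipotentSL_add]
      exact Equiv.sum_comp (Equiv.addLeft x) fun y => ρ (unipotentSL y)
    exact LinearMap.congr_fun this v
  have htrP : LinearMap.trace ℂ V P = Fintype.card F * ε := by
    rw [← hm, card_mul_weightMult]
    simp [P, Representation.character, unipotentHom]
  have hmem : ∀ v, v ∈ (twistRep (ρ.comp (unipotentHom F)) 1).invariants ↔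
      ∀ x, ρ (unipotentSL x) v = v := by
    intro v
    rw [Representation.mem_invariants]
    simp only [twistRep, unipotentHom]
    constructor
    · intro hv x; simpa using hv (Multiplicative.ofAdd x)
    · intro hv x; simpa using hv x.toAdd
  rcases (by omega : ε = 0 ∨ ε = 1) with rfl | rfl
  · refine ⟨1, rfl, fun a ha => ?_⟩
    have hP0 : P = 0 := by
      ext v
      have : P v ∈ (twistRep (ρ.comp (unipotentHom F)) 1).invariants := (hmem _).2 (hP v)
      rw [weightMult, Submodule.finrank_eq_zero] at hm
      rw [hm] at this
      simpa using this
    have := htr a ha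
    rw [hP0, mul_zero, map_zero] at this
    simpa [hq] using this
  · obtain ⟨v, hv0, hv⟩ := finrank_eq_one_iff'.1 hm
    have hv0' : (v : V) ≠ 0 := by simpa using hv0
    have hinv : ∀ (a : Fˣ) x, ρ (unipotentSL x) (ρ (borelSL a 0) v) = ρ (borelSL a 0) v := by
      intro a x
      have hx := borelSL_mul_unipotentSL_eq a (((a⁻¹ : Fˣ) : F) ^ 2 * x)
      rw [← mul_assoc, ← mul_pow, Units.mul_inv, one_pow, one_mul] at hx
      rw [← Module.End.mul_apply, ← map_mul, ← hx, map_mul, Module.End.mul_apply,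
        (hmem _).1 v.2]
    have hl : ∀ a : Fˣ, ∃ c : ℂ, c • (v : V) = ρ (borelSL a 0) v := by
      intro a
      obtain ⟨c, hc⟩ := hv ⟨_, (hmem _).2 (hinv a)⟩
      exact ⟨c, congrArg Subtype.val hc⟩
    choose l hl using hl
    have huniq : ∀ (a : Fˣ) (c : ℂ), ρ (borelSL a 0) v = c • (v : V) → l a = c := by
      intro a c hc
      rw [← hl] at hc
      exact smul_left_injective ℂ hv0' hc
    let L : Fˣ →* ℂ :=
      { toFun := l
        map_one' := huniq _ _ (by rw [borelSL_one, unipotentSL_zero]; simp)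
        map_mul' := fun a b => huniq _ _ (by
          rw [borelSL_mul, map_mul, Module.End.mul_apply, ← hl, map_smul, ← hl, smul_smul,
            mul_comm]) }
    refine ⟨L, huniq _ _ ?_, fun a ha => ?_⟩
    · rw [borelSL_neg_one, h.apply_neg, neg_zero, unipotentSL_zero]; simp
    · have hmulP : ρ (borelSL a 0) * P = l a • P := by
        ext w
        obtain ⟨c, hc⟩ := hv ⟨_, (hmem _).2 (hP w)⟩
        have hc : c • (v : V) = P w := congrArg Subtype.val hc
        rw [Module.End.mul_apply, LinearMap.smul_apply, ← hc, map_smul, ← hl, smul_comm]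
      have := htr a ha
      rw [hmulP, map_smul, htrP, Nat.cast_one, mul_one, smul_eq_mul] at this
      apply mul_left_cancel₀ hq
      rw [this, Nat.cast_one, one_mul, mul_comm]; rfl

end IsHalfDegree

end HalfDegree

section NonsplitRestriction

variable {F : Type*} [Field F] [Fintype F] {V : Type*} [AddCommGroup V] [Module ℂ V]
  [FiniteDimensional ℂ V] {ρ : Representation ℂ (Matrix.SpecialLinearGroup (Fin 2) F) V} {ε n : ℕ}
  {g : Matrix.SpecialLinearGroup (Fin 2) F}

theorem card_filter_units_sq_ne_one (hF : (2 : F) ≠ 0) :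
    ((Finset.univ.filter fun a : Fˣ => (a : F) ^ 2 ≠ 1).card : ℂ) = Fintype.card F - 3 := by
  have hne : (1 : Fˣ) ≠ -1 := by
    intro h
    have := congrArg (Units.val) h
    simp only [Units.val_one, Units.val_neg] at this
    apply hF; linear_combination this
  have hs : (Finset.univ.filter fun a : Fˣ => ¬ (a : F) ^ 2 ≠ 1) = {1, -1} := by
    ext a
    simp only [Finset.mem_filter, Finset.mem_univ, true_and, not_not, Finset.mem_insert,
      Finset.mem_singleton]
    rw [sq_eq_one_iff, Units.ext_iff, Units.ext_iff]; simp
  have h := Finset.card_filter_add_card_filter_not (s := (Finset.univ : Finset Fˣ))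
    (fun a : Fˣ => (a : F) ^ 2 ≠ 1)
  rw [hs, Finset.card_pair hne, Finset.card_univ, Fintype.card_units] at h
  have h1 := Fintype.card_pos (α := F)
  have h2 : (Finset.univ.filter fun a : Fˣ => (a : F) ^ 2 ≠ 1).card + 3 = Fintype.card F := by
    omega
  rw [← h2]; push_cast; ring

theorem IsHalfDegree.sum_nonsplit (h : IsHalfDegree ρ ε) (h5 : 5 < Fintype.card F)
    (hF : (2 : F) ≠ 0) (hg : IsNonsplitGenerator n g) :
    ∑ i ∈ (Finset.range (2 * n)).filter fun i => ¬ 2 * n ∣ 2 * i,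
      ρ.character (g ^ i) * ρ.character (g ^ i)⁻¹ = (1 - ε) * (Fintype.card F - 1) := by
  obtain ⟨l, -, hl⟩ := h.exists_split_character h5
  have hchar : ∀ x, ρ.character (-x) = ρ.character x := fun x => by
    rw [Representation.character, h.apply_neg, Representation.character]
  have key := hg.sum_classFunction hF (fun x => ρ.character x * ρ.character x⁻¹)
    (fun x y hxy => by
      have hxy' : IsConj x⁻¹ y⁻¹ := by
        obtain ⟨c, hc⟩ := isConj_iff.1 hxy
        exact isConj_iff.2 ⟨c, by rw [← hc]; group⟩
      simp only [Representation.character_eq_of_isConj hxy,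
        Representation.character_eq_of_isConj hxy'])
    (fun x => by
      have : (-x)⁻¹ = -x⁻¹ := by
        rw [inv_eq_iff_mul_eq_one]; simp
      simp only [this, hchar])
  have hsplit : ∑ a ∈ Finset.univ.filter fun a : Fˣ => (a : F) ^ 2 ≠ 1,
      ρ.character (borelSL a 0) * ρ.character (borelSL a 0)⁻¹ = (Fintype.card F - 3) * ε := by
    have : ∀ a ∈ Finset.univ.filter fun a : Fˣ => (a : F) ^ 2 ≠ 1,
        ρ.character (borelSL a 0) * ρ.character (borelSL a 0)⁻¹ = ε := by
      intro a ha
      have ha : (a : F) ^ 2 ≠ 1 := by simpa using ha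
      have ha' : ((a⁻¹ : Fˣ) : F) ^ 2 ≠ 1 := by simpa using ha
      have hinv : (borelSL a 0)⁻¹ = borelSL a⁻¹ 0 := by
        rw [inv_eq_iff_mul_eq_one, ← borelSL_mul, mul_inv_cancel, borelSL_one, unipotentSL_zero]
      have hll : l a * l a⁻¹ = 1 := by rw [← map_mul, mul_inv_cancel, map_one]
      rw [hinv, hl a ha, hl _ ha']
      rcases (by have := h.le_one; omega : ε = 0 ∨ ε = 1) with h | h <;> rw [h]
      · simp
      · rw [Nat.cast_one, one_mul, one_mul, hll]
    rw [Finset.sum_congr rfl this, Finset.sum_const, nsmul_eq_mul, card_filter_units_sq_ne_one hF]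
  have hd : 2 * (Module.finrank ℂ V : ℂ) + 1 = Fintype.card F + 2 * ε := by
    exact_mod_cast h.two_mul_finrank
  simp only [h.sum_character, hsplit, h.sum_unipotent h5, inv_one, Representation.char_one] at key
  rw [card_specialLinearGroup_fin_two] at key
  have hq : (Fintype.card F : ℂ) ≠ 0 := by simp
  have hq1 : (Fintype.card F : ℂ) - 1 ≠ 0 := by
    rw [sub_ne_zero]; exact_mod_cast (by omega : Fintype.card F ≠ 1)
  apply mul_left_cancel₀ (mul_ne_zero hq hq1)
  have hd' : (Module.finrank ℂ V : ℂ) = (Fintype.card F + 2 * ε - 1) / 2 := by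
    linear_combination hd / 2
  rw [hd'] at key
  rcases (by have := h.le_one; omega : ε = 0 ∨ ε = 1) with h | h
  · rw [h] at key ⊢
    push_cast at key ⊢
    linear_combination -key
  · rw [h] at key ⊢
    push_cast at key ⊢
    linear_combination -key

/-- The homomorphism from `ℤ / 2n` onto a nonsplit torus. -/
def IsNonsplitGenerator.hom (hg : IsNonsplitGenerator n g) (hn : n ≠ 0) :
    Multiplicative (ZMod (2 * n)) →* Matrix.SpecialLinearGroup (Fin 2) F where
  toFun i := g ^ i.toAdd.val
  map_one' := by simp
  map_mul' i j := by
    have : NeZero (2 * n) := ⟨by omega⟩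
    rw [toAdd_mul, ZMod.val_add, ← pow_eq_pow_mod _ hg.pow_two_mul_eq_one, pow_add]

theorem sum_zmod_eq_sum_range {N : ℕ} [NeZero N] (f : ℕ → ℂ) :
    ∑ i : ZMod N, f i.val = ∑ i ∈ Finset.range N, f i := by
  refine Finset.sum_nbij' (fun i : ZMod N => i.val) (fun i => (i : ZMod N)) ?_ ?_ ?_ ?_ ?_
  · intro i _; exact Finset.mem_range.2 i.val_lt
  · intro i _; exact Finset.mem_univ _
  · intro i _; exact ZMod.natCast_zmod_val i
  · intro i hi; exact ZMod.val_cast_of_lt (Finset.mem_range.1 hi)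
  · intro i _; rfl

theorem IsHalfDegree.sum_torus (h : IsHalfDegree ρ ε) (h5 : 5 < Fintype.card F)
    (hF : (2 : F) ≠ 0) (hg : IsNonsplitGenerator n g) (hn : Fintype.card F + 1 = 2 * n) :
    ∑ i ∈ Finset.range (2 * n), ρ.character (g ^ i) * ρ.character (g ^ i)⁻¹ =
      2 * n * Module.finrank ℂ V := by
  have hs : (Finset.range (2 * n)).filter (fun i => ¬ ¬ 2 * n ∣ 2 * i) = {0, n} := by
    ext i
    simp only [Finset.mem_filter, Finset.mem_range, not_not, Finset.mem_insert,
      Finset.mem_singleton]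
    rw [Nat.mul_dvd_mul_iff_left (by norm_num)]
    constructor
    · rintro ⟨hi, k, rfl⟩
      have : k < 2 := by
        by_contra hk
        have := Nat.mul_le_mul_left n (not_lt.1 hk)
        omega
      interval_cases k <;> simp
    · rintro (rfl | rfl)
      · exact ⟨by omega, dvd_zero _⟩
      · exact ⟨by omega, dvd_refl _⟩
  have h1 : ρ.character (-1) = Module.finrank ℂ V := by
    rw [← Representation.char_one ρ, Representation.character, h.apply_neg,
      Representation.character]
  have hinv : (-1 : Matrix.SpecialLinearGroup (Fin 2) F)⁻¹ = -1 := by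
    rw [inv_eq_iff_mul_eq_one]; simp
  rw [← Finset.sum_filter_add_sum_filter_not _ (fun i => ¬ 2 * n ∣ 2 * i), h.sum_nonsplit h5 hF hg,
    hs, Finset.sum_pair (by omega), hg.pow_eq, pow_zero, inv_one, hinv, h1,
    Representation.char_one]
  have hd : 2 * (Module.finrank ℂ V : ℂ) + 1 = Fintype.card F + 2 * ε := by
    exact_mod_cast h.two_mul_finrank
  have hn' : (Fintype.card F : ℂ) + 1 = 2 * n := by exact_mod_cast hn
  have hd' : (Module.finrank ℂ V : ℂ) = (Fintype.card F + 2 * ε - 1) / 2 := by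
    linear_combination hd / 2
  rw [← hn', hd']
  rcases (by have := h.le_one; omega : ε = 0 ∨ ε = 1) with h | h <;> rw [h] <;> push_cast <;> ring

/-- On a nonsplit torus the character of degree `(q + 1) / 2` vanishes, and the character of degree
`(q - 1) / 2` is the negative of a linear character. -/
theorem IsHalfDegree.exists_nonsplit_character (h : IsHalfDegree ρ ε) (h5 : 5 < Fintype.card F)
    (hF : (2 : F) ≠ 0) (hg : IsNonsplitGenerator n g) (hn : Fintype.card F + 1 = 2 * n) :
    ∃ ψ : AddChar (ZMod (2 * n)) ℂ, ψ n = 1 ∧ ∀ i : ℕ, ¬ 2 * n ∣ 2 * i →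
      ρ.character (g ^ i) = -(1 - ε) * ψ i := by
  have hn0 : n ≠ 0 := by omega
  have : NeZero (2 * n) := ⟨by omega⟩
  let σ : Representation ℂ (Multiplicative (ZMod (2 * n))) V := ρ.comp (hg.hom hn0)
  let m := weightMult σ
  have hchar : ∀ i : ZMod (2 * n), σ.character (Multiplicative.ofAdd i) =
      ρ.character (g ^ i.val) := fun i => rfl
  have hcharnat : ∀ i : ℕ, σ.character
      (Multiplicative.ofAdd (i : ZMod (2 * n))) = ρ.character (g ^ i) := fun i => by
    rw [hchar, ZMod.val_natCast, ← pow_eq_pow_mod _ hg.pow_two_mul_eq_one]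
  have hfin : Module.finrank ℂ V = ∑ ψ, m ψ := finrank_eq_sum_weightMult σ
  have hsq : ∑ ψ, (m ψ : ℂ) ^ 2 = ∑ ψ, (m ψ : ℂ) := by
    have h1 := sum_character_mul_character_neg σ
    have h2 : ∑ a : ZMod (2 * n), σ.character (Multiplicative.ofAdd a) *
        σ.character (Multiplicative.ofAdd (-a)) =
        ∑ i ∈ Finset.range (2 * n), ρ.character (g ^ i) * ρ.character (g ^ i)⁻¹ := by
      rw [← sum_zmod_eq_sum_range (fun i => ρ.character (g ^ i) * ρ.character (g ^ i)⁻¹)]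
      refine Finset.sum_congr rfl fun i _ => ?_
      rw [hchar]
      exact congrArg _ (congrArg ρ.character (map_inv (hg.hom hn0) (Multiplicative.ofAdd i)))
    rw [h2, h.sum_torus h5 hF hg hn, hfin, ZMod.card] at h1
    push_cast at h1
    have hc : (2 * n : ℂ) ≠ 0 := by simpa using hn0
    exact (mul_left_cancel₀ hc h1).symm
  have hle : ∀ ψ, m ψ ≤ 1 := by
    have hsq' : ∑ ψ, m ψ ^ 2 = ∑ ψ, m ψ := by exact_mod_cast hsq
    have := (Finset.sum_eq_sum_iff_of_le (s := Finset.univ) fun ψ _ =>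
      Nat.le_self_pow two_ne_zero (m ψ)).1 hsq'.symm
    intro ψ
    have := this ψ (Finset.mem_univ _)
    by_contra hlt
    nlinarith
  have hchn : ∀ x, ρ.character (g ^ n * x) = ρ.character x := by
    intro x
    rw [hg.pow_eq, neg_one_mul, Representation.character, h.apply_neg, Representation.character]
  have hsupp : ∀ ψ, m ψ ≠ 0 → ψ (n : ZMod (2 * n)) = 1 := by
    intro ψ hψ
    have h1 := card_mul_weightMult σ ψ
    have h2 : ψ (n : ZMod (2 * n)) * ∑ a : ZMod (2 * n), ψ (-a) *
        σ.character (Multiplicative.ofAdd a) =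
        ∑ a : ZMod (2 * n), ψ (-a) *
        σ.character (Multiplicative.ofAdd a) := by
      rw [Finset.mul_sum]
      refine Fintype.sum_equiv (Equiv.subRight (n : ZMod (2 * n))) _ _ fun a => ?_
      rw [Equiv.subRight_apply, neg_sub, sub_eq_add_neg, AddChar.map_add_eq_mul, mul_assoc]
      congr 2
      have h3 : Multiplicative.ofAdd a = Multiplicative.ofAdd (n : ZMod (2 * n)) *
          Multiplicative.ofAdd (a - n) := by rw [← ofAdd_add, add_sub_cancel]
      conv_lhs => rw [h3]
      have h4 : hg.hom hn0 (Multiplicative.ofAdd (n : ZMod (2 * n))) = g ^ n := by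
        change g ^ (n : ZMod (2 * n)).val = g ^ n
        rw [ZMod.val_natCast, ← pow_eq_pow_mod _ hg.pow_two_mul_eq_one]
      change ρ.character (hg.hom hn0 _) = ρ.character (hg.hom hn0 _)
      rw [map_mul, h4, hchn]
    rw [← h1] at h2
    refine mul_right_cancel₀ (b := ((Fintype.card (ZMod (2 * n)) : ℂ) * m ψ)) ?_ (by rw [h2, one_mul])
    simpa [hn0] using hψ
  let E : Finset (AddChar (ZMod (2 * n)) ℂ) := Finset.univ.filter fun ψ => ψ (n : ZMod (2 * n)) = 1
  have hE : ∀ i : ZMod (2 * n), 2 * ∑ ψ ∈ E, ψ i =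
      ∑ ψ : AddChar (ZMod (2 * n)) ℂ, ψ i + ∑ ψ : AddChar (ZMod (2 * n)) ℂ, ψ (i + n) := by
    intro i
    rw [Finset.sum_filter, Finset.mul_sum, ← Finset.sum_add_distrib]
    refine Finset.sum_congr rfl fun ψ _ => ?_
    have h1 : ψ (n : ZMod (2 * n)) ^ 2 = 1 := by
      rw [← AddChar.map_nsmul_eq_pow, nsmul_eq_mul, ← Nat.cast_mul, ZMod.natCast_self,
        AddChar.map_zero_eq_one]
    rw [AddChar.map_add_eq_mul]
    rcases sq_eq_one_iff.1 h1 with h2 | h2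
    · rw [if_pos h2, h2]; ring
    · rw [if_neg (by rw [h2]; norm_num), h2]; ring
  have hE0 : ∀ i : ℕ, ¬ 2 * n ∣ 2 * i → ∑ ψ ∈ E, ψ (i : ZMod (2 * n)) = 0 := by
    intro i hi
    have h1 : (i : ZMod (2 * n)) ≠ 0 := by
      rw [Ne, ZMod.natCast_eq_zero_iff]
      exact fun h => hi (h.mul_left 2)
    have h2 : (i : ZMod (2 * n)) + n ≠ 0 := by
      rw [← Nat.cast_add, Ne, ZMod.natCast_eq_zero_iff]
      intro h
      have h3 := h.mul_left 2
      rw [mul_add] at h3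
      exact hi ((Nat.dvd_add_left (dvd_refl _)).1 h3)
    have := hE i
    rw [AddChar.sum_apply_eq_ite, AddChar.sum_apply_eq_ite, if_neg h1, if_neg h2] at this
    simpa using this
  have hEcard : E.card = n := by
    have h1 := hE 0
    have h2 : (n : ZMod (2 * n)) ≠ 0 := by
      rw [Ne, ZMod.natCast_eq_zero_iff]
      intro h; have := Nat.le_of_dvd (by omega) h; omega
    rw [zero_add, AddChar.sum_apply_eq_ite, AddChar.sum_apply_eq_ite, if_neg h2] at h1
    simp only [AddChar.map_zero_eq_one, if_true, ZMod.card, Finset.sum_const, nsmul_eq_mul,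
      mul_one, add_zero] at h1
    have h1 : 2 * E.card = 2 * n := by exact_mod_cast h1
    omega
  have hXE : ∀ i : ℕ, ρ.character (g ^ i) = ∑ ψ ∈ E, m ψ * ψ i := by
    intro i
    rw [← hcharnat, character_eq_sum_weightMult, Finset.sum_filter_of_ne]
    intro ψ _ hne
    exact hsupp ψ fun h0 => hne (by change (m ψ : ℂ) * _ = 0; rw [h0]; simp)
  have hfinE : Module.finrank ℂ V = ∑ ψ ∈ E, m ψ := by
    rw [hfin, Finset.sum_filter_of_ne]
    exact fun ψ _ hne => hsupp ψ hne
  have hdef : ∑ ψ ∈ E, (1 - m ψ) + ε = 1 := by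
    have h1 : ∑ ψ ∈ E, (1 - m ψ) + ∑ ψ ∈ E, m ψ = n := by
      rw [← Finset.sum_add_distrib, Finset.sum_congr rfl fun ψ _ => Nat.sub_add_cancel (hle ψ)]
      simp [hEcard]
    have := h.two_mul_finrank
    have := h.le_one
    omega
  have hX' : ∀ i : ℕ, ¬ 2 * n ∣ 2 * i → ρ.character (g ^ i) = -∑ ψ ∈ E, ((1 - m ψ : ℕ) : ℂ) * ψ i := by
    intro i hi
    rw [hXE, ← Finset.sum_neg_distrib, ← sub_eq_zero, ← Finset.sum_sub_distrib, ← hE0 i hi]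
    refine Finset.sum_congr rfl fun ψ _ => ?_
    rw [Nat.cast_sub (hle ψ)]; push_cast; ring
  rcases (by have := h.le_one; omega : ε = 0 ∨ ε = 1) with h0 | h0
  · rw [h0] at hdef ⊢
    obtain ⟨ψ, hψE, hψ⟩ : ∃ ψ ∈ E, 1 - m ψ ≠ 0 := Finset.exists_ne_zero_of_sum_ne_zero (by omega)
    have hψ1 : 1 - m ψ = 1 := by omega
    refine ⟨ψ, (Finset.mem_filter.1 hψE).2, fun i hi => ?_⟩
    have hrest : ∀ ψ' ∈ E, ψ' ≠ ψ → 1 - m ψ' = 0 := by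
      rw [← Finset.add_sum_erase _ _ hψE, hψ1] at hdef
      have : ∑ ψ' ∈ E.erase ψ, (1 - m ψ') = 0 := by omega
      intro ψ' h1 h2
      exact (Finset.sum_eq_zero_iff.1 this) ψ' (Finset.mem_erase.2 ⟨h2, h1⟩)
    rw [hX' i hi, Finset.sum_eq_single_of_mem ψ hψE fun ψ' h1 h2 => by rw [hrest ψ' h1 h2]; simp,
      hψ1]
    simp
  · rw [h0] at hdef ⊢
    refine ⟨1, rfl, fun i hi => ?_⟩
    have : ∑ ψ ∈ E, (1 - m ψ) = 0 := by omega
    rw [hX' i hi, Finset.sum_eq_zero fun ψ hψ => by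
      rw [(Finset.sum_eq_zero_iff.1 this) ψ hψ]; simp]
    simp

end NonsplitRestriction

section Values

variable {F : Type*} [Field F] [Fintype F] {V : Type*} [AddCommGroup V] [Module ℂ V]
  [FiniteDimensional ℂ V] {ρ : Representation ℂ (Matrix.SpecialLinearGroup (Fin 2) F) V} {ε n : ℕ}
  {g x y : Matrix.SpecialLinearGroup (Fin 2) F}

omit [Fintype F] in
theorem borelSL_pow (a : Fˣ) (m : ℕ) : borelSL a 0 ^ m = borelSL (a ^ m) 0 := by
  induction m with
  | zero => rw [pow_zero, pow_zero, borelSL_one, unipotentSL_zero]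
  | succ m ih => rw [pow_succ, ih, pow_succ, borelSL_mul]

omit [Fintype F] in
theorem IsConj.pow_eq_one_or_neg_one (h : IsConj x y) {m : ℕ} (hx : x ^ m = 1 ∨ x ^ m = -1) :
    y ^ m = 1 ∨ y ^ m = -1 := by
  have hm := h.pow m
  rcases hx with hx | hx <;> rw [hx] at hm
  · exact Or.inl (isConj_one_right.1 hm)
  · obtain ⟨c, hc⟩ := isConj_iff.1 hm
    exact Or.inr (by rw [← hc, mul_neg_one, neg_mul, mul_inv_cancel])

omit [Fintype F] in
theorem pow_eq_one_or_neg_one_of_borelSL {a : Fˣ} {m : ℕ}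
    (h : borelSL a 0 ^ m = 1 ∨ borelSL a 0 ^ m = -1) : a ^ m = 1 ∨ a ^ m = -1 := by
  rw [borelSL_pow] at h
  refine h.imp (fun h => ?_) (fun h => ?_) <;>
  · have := congrArg (fun z : Matrix.SpecialLinearGroup (Fin 2) F => z 0 0) h
    ext
    simpa [borelSL] using this

omit [Fintype F] in
theorem traceSL_sq_of_eq_one_or_neg_one (h : x = 1 ∨ x = -1) : traceSL x ^ 2 = 4 := by
  rcases h with rfl | rfl <;> simp [traceSL] <;> norm_num

omit [Fintype F] in
theorem traceSL_inv (x : Matrix.SpecialLinearGroup (Fin 2) F) : traceSL x⁻¹ = traceSL x := by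
  simp [traceSL, Matrix.SpecialLinearGroup.SL2_inv_expl, add_comm]

omit [Fintype F] in
theorem traceSL_sq_ne_four_of_pow_seven (hF : (2 : F) ≠ 0) (h7 : (7 : F) ≠ 0)
    (hx : x ^ 7 = 1 ∨ x ^ 7 = -1) (hx1 : x ≠ 1) (hx2 : x ≠ -1) : traceSL x ^ 2 ≠ 4 := by
  intro ht
  have h14 : x ^ 14 = 1 := by
    rw [show 14 = 7 * 2 from rfl, pow_mul]
    rcases hx with h | h <;> rw [h] <;> simp
  have hm : ((14 : ℕ) : F) ≠ 0 := by
    have : ((14 : ℕ) : F) = 2 * 7 := by norm_num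
    rw [this]; exact mul_ne_zero hF h7
  rcases eq_one_or_eq_neg_one_of_pow_eq_one ht hm (by decide) h14 with h | h
  exacts [hx1 h, hx2 h]

theorem eq_one_of_pow_seven_of_sq {z : ℂ} (h7 : z ^ 7 = 1) (h2 : z ^ 2 = 1) : z = 1 := by
  have : z ^ 7 = (z ^ 2) ^ 3 * z := by ring
  rw [h7, h2] at this
  simpa using this.symm

theorem IsNonsplitGenerator.dvd_mul_seven (hg : IsNonsplitGenerator n g) {i : ℕ}
    (h : (g ^ i) ^ 7 = 1 ∨ (g ^ i) ^ 7 = -1) : n ∣ i * 7 := by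
  rw [← pow_mul] at h
  by_contra hi
  refine (hg.not_dvd_iff (i * 7)).2 ?_ (traceSL_sq_of_eq_one_or_neg_one h)
  rwa [Nat.mul_dvd_mul_iff_left (by norm_num)]

/-- The value of a half-degree character on elements of order seven of a split torus. -/
theorem IsHalfDegree.character_of_card_mod_eq_one (h : IsHalfDegree ρ ε) (h5 : 5 < Fintype.card F)
    (hF : (2 : F) ≠ 0) (h7 : (7 : F) ≠ 0) (hg : IsNonsplitGenerator n g)
    (hn : Fintype.card F + 1 = 2 * n) (hq : Fintype.card F % 7 = 1)
    (hx : x ^ 7 = 1 ∨ x ^ 7 = -1) (hx1 : x ≠ 1) (hx2 : x ≠ -1) : ρ.character x = ε := by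
  rcases hg.isConj_borelSL_or_isConj_pow hF (traceSL_sq_ne_four_of_pow_seven hF h7 hx hx1 hx2) with
    ⟨a, ha, hax⟩ | ⟨i, hi, hix⟩
  · obtain ⟨l, hl1, hl⟩ := h.exists_split_character h5
    rw [Representation.character_eq_of_isConj hax, hl a ha]
    rcases (by have := h.le_one; omega : ε = 0 ∨ ε = 1) with h0 | h0
    · simp [h0]
    have hl7 : l a ^ 7 = 1 := by
      rw [← map_pow]
      rcases pow_eq_one_or_neg_one_of_borelSL (hax.pow_eq_one_or_neg_one hx) with h | h <;> rw [h]
      exacts [map_one l, hl1]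
    have ha' : ((a⁻¹ : Fˣ) : F) ^ 2 ≠ 1 := by simpa using ha
    have hl2 : l a ^ 2 = 1 := by
      have := Representation.character_eq_of_isConj (ρ := ρ) (isConj_borelSL_inv a)
      rw [hl a ha, hl _ ha', h0, Nat.cast_one, one_mul, one_mul] at this
      rw [sq]; nth_rewrite 1 [this]
      rw [← map_mul, inv_mul_cancel, map_one]
    rw [eq_one_of_pow_seven_of_sq hl7 hl2, mul_one]
  · exfalso
    have h1 := hg.dvd_mul_seven (hix.pow_eq_one_or_neg_one hx)
    have hc : Nat.Coprime n 7 := by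
      rw [Nat.coprime_comm, Nat.Prime.coprime_iff_not_dvd (by norm_num)]
      omega
    exact hi (Nat.mul_dvd_mul_left 2 (hc.dvd_of_dvd_mul_right h1))

/-- The value of a half-degree character on elements of order seven of a nonsplit torus. -/
theorem IsHalfDegree.character_of_card_mod_eq_six (h : IsHalfDegree ρ ε) (h5 : 5 < Fintype.card F)
    (hF : (2 : F) ≠ 0) (h7 : (7 : F) ≠ 0) (hg : IsNonsplitGenerator n g)
    (hn : Fintype.card F + 1 = 2 * n) (hq : Fintype.card F % 7 = 6)
    (hx : x ^ 7 = 1 ∨ x ^ 7 = -1) (hx1 : x ≠ 1) (hx2 : x ≠ -1) :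
    ρ.character x = -(1 - ε) := by
  rcases hg.isConj_borelSL_or_isConj_pow hF (traceSL_sq_ne_four_of_pow_seven hF h7 hx hx1 hx2) with
    ⟨a, ha, hax⟩ | ⟨i, hi, hix⟩
  · exfalso
    have ha14 : a ^ (2 * 7) = 1 := by
      rw [mul_comm, pow_mul]
      rcases pow_eq_one_or_neg_one_of_borelSL (hax.pow_eq_one_or_neg_one hx) with h | h <;>
        rw [h] <;> simp
    have hc : Nat.Coprime (orderOf a) 7 := by
      have h1 : orderOf a ∣ Fintype.card F - 1 := by
        rw [← Fintype.card_units]; exact orderOf_dvd_card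
      rw [Nat.coprime_comm, Nat.Prime.coprime_iff_not_dvd (by norm_num)]
      intro h2
      have := h2.trans h1
      omega
    have h2 := orderOf_dvd_iff_pow_eq_one.1 (hc.dvd_of_dvd_mul_right (orderOf_dvd_of_pow_eq_one ha14))
    apply ha
    rw [← Units.val_pow_eq_pow_val, h2, Units.val_one]
  · obtain ⟨ψ, hψn, hψ⟩ := h.exists_nonsplit_character h5 hF hg hn
    rw [Representation.character_eq_of_isConj hix, hψ i hi]
    rcases (by have := h.le_one; omega : ε = 0 ∨ ε = 1) with h0 | h0
    swap
    · simp [h0]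
    have h7 : ψ (i : ZMod (2 * n)) ^ 7 = 1 := by
      obtain ⟨k, hk⟩ := hg.dvd_mul_seven (hix.pow_eq_one_or_neg_one hx)
      rw [← AddChar.map_nsmul_eq_pow, nsmul_eq_mul, ← Nat.cast_mul, (by omega : 7 * i = i * 7), hk,
        (Nat.mul_comm n k : n * k = k * n), Nat.cast_mul, ← nsmul_eq_mul, AddChar.map_nsmul_eq_pow, hψn, one_pow]
    have hinv : (g ^ i)⁻¹ = g ^ ((2 * n - 1) * i) := by
      rw [inv_eq_iff_mul_eq_one, ← pow_add]
      have : i + (2 * n - 1) * i = 2 * n * i := by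
        nth_rewrite 1 [← one_mul i]
        rw [← add_mul, Nat.add_sub_cancel' (by omega)]
      rw [this, pow_mul, hg.pow_two_mul_eq_one, one_pow]
    have hi' : ¬ 2 * n ∣ 2 * ((2 * n - 1) * i) := by
      rw [← hg.not_dvd_iff, ← hinv, traceSL_inv]
      exact (hg.not_dvd_iff i).2 hi
    have hconj : IsConj (g ^ i) (g ^ ((2 * n - 1) * i)) := by
      have h1 := hg.isConj_pow hF hi'
      rw [← hinv, traceSL_inv, hinv] at h1
      exact (hg.isConj_pow hF hi).trans h1.symm
    have hval : ψ (i : ZMod (2 * n)) * ψ (((2 * n - 1) * i : ℕ) : ZMod (2 * n)) = 1 := by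
      rw [← AddChar.map_add_eq_mul, ← Nat.cast_add]
      have : i + (2 * n - 1) * i = 2 * n * i := by
        nth_rewrite 1 [← one_mul i]
        rw [← add_mul, Nat.add_sub_cancel' (by omega)]
      rw [this, Nat.cast_mul, ZMod.natCast_self, zero_mul, AddChar.map_zero_eq_one]
    have h2 : ψ (i : ZMod (2 * n)) ^ 2 = 1 := by
      have := Representation.character_eq_of_isConj (ρ := ρ) hconj
      rw [hψ i hi, hψ _ hi', h0, Nat.cast_zero, sub_zero, neg_one_mul, neg_one_mul, neg_inj] at this
      rw [← this, ← sq] at hval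
      exact hval
    rw [eq_one_of_pow_seven_of_sq h7 h2, mul_one]

end Values

section Restriction

theorem MonoidHom.card_mul_sum_comp {G H : Type*} [Group G] [Group H] [Fintype G] [Fintype H]
    (φ : G →* H) (hφ : Function.Surjective φ) (f : H → ℂ) :
    (Fintype.card H : ℂ) * ∑ g, f (φ g) = Fintype.card G * ∑ h, f h := by
  have key : ∀ f : H → ℂ, ∑ g, f (φ g) =
      ((Finset.univ.filter fun g => φ g = 1).card : ℂ) * ∑ h, f h := by
    intro f
    rw [← Finset.sum_fiberwise _ φ, Finset.mul_sum]
    refine Finset.sum_congr rfl fun h _ => ?_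
    have hcard := MonoidHom.card_fiber_eq_of_mem_range φ (x := h) (y := 1) (hφ h) (hφ 1)
    rw [← hcard, ← nsmul_eq_mul]
    refine Finset.sum_eq_card_nsmul fun g hg => ?_
    rw [(Finset.mem_filter.1 hg).2]
  have h1 := key fun _ => 1
  simp only [Finset.sum_const, Finset.card_univ, nsmul_eq_mul, mul_one] at h1
  rw [key f, h1]; ring

theorem restMult_of_eq_const {G : Type} [Group G] [Finite G] (H : Subgroup G) {θ : H →* ℂˣ}
    (hθ : θ ≠ 1) {χ : G → ℂ} {c : ℂ} (hc : ∀ h ∈ H, h ≠ 1 → χ h = c) :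
    restMult H θ χ = (χ 1 - c) / Nat.card H := by
  let : Fintype H := Fintype.ofFinite H
  have hne : (Units.coeHom ℂ).comp θ⁻¹ ≠ 1 := by
    obtain ⟨h, hh⟩ := DFunLike.ne_iff.1 hθ
    refine DFunLike.ne_iff.2 ⟨h, fun h1 => hh ?_⟩
    have h2 : ((θ h)⁻¹ : ℂˣ) = 1 := Units.ext h1
    simpa using h2
  have hsum : ∑ h : H, ((θ h : ℂ))⁻¹ = 0 := by
    rw [← sum_hom_units_eq_zero _ hne]
    exact Finset.sum_congr rfl fun h _ => by simp
  have h1 : ∑ h : H, (χ h - c) * ((θ h : ℂ))⁻¹ = χ 1 - c := by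
    rw [Finset.sum_eq_single (1 : H)]
    · simp
    · intro h _ hh
      rw [hc h h.2 (by simpa using hh), sub_self, zero_mul]
    · simp
  have h2 : ∑ h : H, χ h * ((θ h : ℂ))⁻¹ = χ 1 - c := by
    rw [← h1]
    simp only [sub_mul, Finset.sum_sub_distrib, ← Finset.mul_sum, hsum, mul_zero, sub_zero]
  change (Nat.card H : ℂ)⁻¹ * ∑ h : H, χ h * ((θ h : ℂ))⁻¹ = _
  rw [h2, div_eq_inv_mul]

end Restriction

section ProjectiveSpecialLinear

variable {F : Type} [Field F]

theorem PSL2.mk_eq_one_iff {x : Matrix.SpecialLinearGroup (Fin 2) F} :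
    (QuotientGroup.mk x : PSL2 F) = 1 ↔ x = 1 ∨ x = -1 := by
  rw [QuotientGroup.eq_one_iff, Matrix.SpecialLinearGroup.mem_center_iff]
  constructor
  · rintro ⟨r, hr, hx⟩
    rw [Fintype.card_fin, sq_eq_one_iff] at hr
    rcases hr with rfl | rfl
    · exact Or.inl (Subtype.ext (by rw [← hx]; simp))
    · exact Or.inr (Subtype.ext (by rw [← hx, map_neg, map_one]; rfl))
  · rintro (rfl | rfl)
    · exact ⟨1, by simp, by simp⟩
    · exact ⟨-1, by simp, by rw [map_neg, map_one]; rfl⟩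

/-- The representation of `SL(2, F)` inflated from a representation of `PSL(2, F)`. -/
noncomputable def inflation (V : FDRep ℂ (PSL2 F)) :
    Representation ℂ (Matrix.SpecialLinearGroup (Fin 2) F) V :=
  V.ρ.comp (QuotientGroup.mk' _)

theorem inflation_character (V : FDRep ℂ (PSL2 F)) (x : Matrix.SpecialLinearGroup (Fin 2) F) :
    (inflation V).character x = V.character (QuotientGroup.mk x) := rfl

variable [Fintype F]

theorem isHalfDegree_inflation (V : FDRep ℂ (PSL2 F)) [CategoryTheory.Simple V] {ε : ℕ}
    (hε : ε ≤ 1) (hV : 2 * V.character 1 + 1 = Fintype.card F + 2 * ε) :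
    IsHalfDegree (inflation V) ε where
  map_neg_one := by
    change V.ρ (QuotientGroup.mk (-1)) = 1
    rw [PSL2.mk_eq_one_iff.2 (Or.inr rfl), map_one]
  sum_character := by
    let : Fintype (PSL2 F) := Fintype.ofFinite _
    have hc : (Nat.card (PSL2 F) : ℂ) ≠ 0 := by simp
    let : Invertible (Nat.card (PSL2 F) : ℂ) := invertibleOfNonzero hc
    have h1 := FDRep.char_orthonormal V V
    rw [if_pos ⟨CategoryTheory.Iso.refl V⟩, inv_mul_eq_iff_eq_mul₀ hc, mul_one] at h1
    have h2 := MonoidHom.card_mul_sum_comp (QuotientGroup.mk' (Subgroup.center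
      (Matrix.SpecialLinearGroup (Fin 2) F))) (QuotientGroup.mk'_surjective _)
      fun g => V.character g * V.character g⁻¹
    rw [h1, ← Nat.card_eq_fintype_card, mul_comm] at h2
    exact mul_right_cancel₀ hc h2
  two_mul_finrank := by
    rw [FDRep.char_one] at hV
    exact_mod_cast hV
  le_one := hε

theorem PSL2.character_of_pow_seven (V : FDRep ℂ (PSL2 F)) [CategoryTheory.Simple V] {ε : ℕ}
    (hε : ε ≤ 1) (hV : 2 * V.character 1 + 1 = Fintype.card F + 2 * ε) (h5 : 5 < Fintype.card F)
    (hF : (2 : F) ≠ 0) (h7 : (7 : F) ≠ 0) {g : PSL2 F} (hg : g ^ 7 = 1) (hg1 : g ≠ 1) :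
    (Fintype.card F % 7 = 1 → V.character g = ε) ∧
      (Fintype.card F % 7 = 6 → V.character g = -(1 - ε)) := by
  obtain ⟨x, rfl⟩ := QuotientGroup.mk_surjective g
  have hx := PSL2.mk_eq_one_iff.1 hg
  have hx1 : x ≠ 1 := fun h => hg1 (PSL2.mk_eq_one_iff.2 (Or.inl h))
  have hx2 : x ≠ -1 := fun h => hg1 (PSL2.mk_eq_one_iff.2 (Or.inr h))
  have hodd : Fintype.card F % 2 = 1 :=
    FiniteField.odd_card_of_char_ne_two fun h => hF (by
      have := ringChar.Nat.cast_ringChar (R := F)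
      rw [h] at this; exact_mod_cast this)
  obtain ⟨n, hn⟩ : ∃ n, Fintype.card F + 1 = 2 * n := ⟨(Fintype.card F + 1) / 2, by omega⟩
  obtain ⟨y, hy⟩ := exists_isNonsplitGenerator hF hn
  have h := isHalfDegree_inflation V hε hV
  rw [← inflation_character]
  exact ⟨fun hq => h.character_of_card_mod_eq_one h5 hF h7 hy hn hq hx hx1 hx2,
    fun hq => h.character_of_card_mod_eq_six h5 hF h7 hy hn hq hx hx1 hx2⟩

end ProjectiveSpecialLinear

theorem natCast_ne_zero_of_not_dvd_card {F : Type*} [Field F] [Fintype F] {p : ℕ} (hp : p.Prime)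
    (h : ¬ p ∣ Fintype.card F) : (p : F) ≠ 0 := by
  intro h0
  have h1 := CharP.ringChar_of_prime_eq_zero hp h0
  obtain ⟨n, -, hn⟩ := FiniteField.card F (ringChar F)
  rw [h1] at hn
  exact h (hn ▸ dvd_pow_self p n.ne_zero)

theorem MonoidHom.pow_ne_one_of_injective {G M : Type*} [Group G] [CommGroup M] (θ : G →* M)
    (hθ : Function.Injective θ) {p k : ℕ} (hp : p.Prime) (hG : Nat.card G = p) (hk : 0 < k)
    (hkp : k < p) : θ ^ k ≠ 1 := by
  intro h
  have : Finite G := Nat.finite_of_card_ne_zero (hG ▸ hp.ne_zero)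
  have : Nontrivial G := Finite.one_lt_card_iff_nontrivial.1 (hG ▸ hp.one_lt)
  obtain ⟨x, hx⟩ := exists_ne (1 : G)
  have h1 : x ^ k = 1 := hθ (by rw [map_pow, map_one]; exact DFunLike.congr_fun h x)
  have h2 : x ^ p = 1 := by rw [← hG]; exact pow_card_eq_one'
  have h3 : Nat.Coprime k p := (Nat.coprime_of_lt_prime hk.ne' hkp hp).symm
  have h4 := Nat.dvd_gcd (orderOf_dvd_of_pow_eq_one h1) (orderOf_dvd_of_pow_eq_one h2)
  rw [h3] at h4
  exact hx (orderOf_eq_one_iff.1 (Nat.dvd_one.1 h4))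

theorem induced_H7_multiplicities_half_degree
    (q : ℕ) (hq : IsPrimePow q) (hgcd : Nat.Coprime q 42)
    (hq7 : q % 7 = 1 ∨ q % 7 = 6)
    (F : Type) [Field F] [Fintype F] (hF : Fintype.card F = q)
    (H2 H3 H7 : Subgroup (PSL2 F))
    (hH2 : Nat.card H2 = 2) (hH3 : Nat.card H3 = 3) (hH7 : Nat.card H7 = 7)
    (θ2 : H2 →* ℂˣ) (θ3 : H3 →* ℂˣ) (θ7 : H7 →* ℂˣ)
    (hθ2 : Function.Injective θ2) (hθ3 : Function.Injective θ3)
    (hθ7 : Function.Injective θ7)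
    (k : ℕ) (hk : k ∈ Finset.Icc (1:ℕ) 6)
    (χ : PSL2 F → ℂ) (hχ : IsIrrCharacter (PSL2 F) χ)
    :
    (((q % 28 = 1 ∧ χ 1 = ((q : ℂ) + 1) / 2) ∨ (q % 28 = 15 ∧ χ 1 = ((q : ℂ) - 1) / 2)) →
      restMult H7 (θ7 ^ k) χ = ((q : ℂ) - 1) / 14) ∧
    (((q % 28 = 13 ∧ χ 1 = ((q : ℂ) + 1) / 2) ∨ (q % 28 = 27 ∧ χ 1 = ((q : ℂ) - 1) / 2)) →
      restMult H7 (θ7 ^ k) χ = ((q : ℂ) + 1) / 14) := by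
  have hp := hq.one_lt
  have hq2 : ¬ 2 ∣ q := fun h => by
    have := Nat.dvd_gcd h (by norm_num : 2 ∣ 42); rw [hgcd] at this; omega
  have hq3 : ¬ 3 ∣ q := fun h => by
    have := Nat.dvd_gcd h (by norm_num : 3 ∣ 42); rw [hgcd] at this; omega
  have h5 : 5 < Fintype.card F := by omega
  have hF2 : (2 : F) ≠ 0 := by
    exact_mod_cast natCast_ne_zero_of_not_dvd_card (F := F) Nat.prime_two (hF ▸ hq2)
  have hF7 : (7 : F) ≠ 0 := by
    exact_mod_cast natCast_ne_zero_of_not_dvd_card (F := F) (p := 7) (by norm_num) (by omega)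
  obtain ⟨V, hV, rfl⟩ := hχ
  rw [Finset.mem_Icc] at hk
  have hθ : θ7 ^ k ≠ 1 := θ7.pow_ne_one_of_injective hθ7 (p := 7) (by norm_num) hH7 hk.1 (by omega)
  have hval : ∀ {ε : ℕ}, ε ≤ 1 → 2 * V.character 1 + 1 = q + 2 * ε → ∀ h ∈ H7, h ≠ 1 →
      (q % 7 = 1 → V.character h = ε) ∧ (q % 7 = 6 → V.character h = -(1 - ε)) := by
    intro ε hε hV1 h hh h1
    have h7 : h ^ 7 = 1 := by
      have h2 : (⟨h, hh⟩ : H7) ^ Nat.card H7 = 1 := pow_card_eq_one'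
      rw [hH7] at h2
      exact congrArg Subtype.val h2
    subst hF
    exact PSL2.character_of_pow_seven V hε hV1 h5 hF2 hF7 h7 h1
  constructor
  · rintro (⟨hm, h1⟩ | ⟨hm, h1⟩)
    · rw [restMult_of_eq_const H7 hθ fun h hh hne =>
        (hval le_rfl (by rw [h1]; push_cast; ring) h hh hne).1 (by omega), h1, hH7]
      push_cast; ring
    · rw [restMult_of_eq_const H7 hθ fun h hh hne =>
        (hval zero_le_one (by rw [h1]; push_cast; ring) h hh hne).1 (by omega), h1, hH7]
      push_cast; ring
  · rintro (⟨hm, h1⟩ | ⟨hm, h1⟩)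
    · rw [restMult_of_eq_const H7 hθ fun h hh hne =>
        (hval le_rfl (by rw [h1]; push_cast; ring) h hh hne).2 (by omega), h1, hH7]
      push_cast; ring
    · rw [restMult_of_eq_const H7 hθ fun h hh hne =>
        (hval zero_le_one (by rw [h1]; push_cast; ring) h hh hne).2 (by omega), h1, hH7]
      push_cast; ring
end

section
/- For each n ∈ {2, 3, 7}, any two subgroups of G of order n are conjugate in G; that is, the subgroup of G of order n is unique up to conjugacy. -/
open scoped BigOperators Classical

namespace Matrix.SpecialLinearGroup

variable {F : Type} [Field F]

lemma sq_trace_eq_four_of_mem_center {A : SpecialLinearGroup (Fin 2) F}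
    (hA : A ∈ Subgroup.center (SpecialLinearGroup (Fin 2) F)) :
    trace (A : Matrix (Fin 2) (Fin 2) F) ^ 2 = 4 := by
  obtain ⟨r, hr, hA⟩ := mem_center_iff.mp hA
  rw [← hA]
  simp only [Fintype.card_fin] at hr
  simp only [scalar_apply, trace_fin_two, diagonal_apply_eq]
  linear_combination 4 * hr

/-- The Cayley-Hamilton theorem in `SL(2, F)`. -/
lemma coe_mul_self_eq (A : SpecialLinearGroup (Fin 2) F) :
    (A : Matrix (Fin 2) (Fin 2) F) * A
      = trace (A : Matrix (Fin 2) (Fin 2) F) • (A : Matrix (Fin 2) (Fin 2) F) - 1 := by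
  have h := A.det_coe
  rw [det_fin_two] at h
  ext i j
  fin_cases i <;> fin_cases j <;> simp [mul_apply, Fin.sum_univ_two, trace_fin_two]
  · linear_combination -h
  · ring
  · ring
  · linear_combination -h

/-- If a power of a non-central `A` is central, then the coefficient of `A` in its
Cayley-Hamilton reduction vanishes. -/
lemma coeff_eq_zero_of_mem_center {A B : SpecialLinearGroup (Fin 2) F}
    (hA : A ∉ Subgroup.center (SpecialLinearGroup (Fin 2) F))
    (hB : B ∈ Subgroup.center (SpecialLinearGroup (Fin 2) F)) {u v : F}
    (h : (B : Matrix (Fin 2) (Fin 2) F) = u • (A : Matrix (Fin 2) (Fin 2) F) + v • 1) :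
    u = 0 := by
  by_contra hu
  apply hA
  obtain ⟨r, -, hr⟩ := mem_center_iff.mp hB
  rw [← hr] at h
  have h01 : A 0 1 = 0 := by simpa [hu] using congr_fun₂ h 0 1
  have h10 : A 1 0 = 0 := by simpa [hu] using congr_fun₂ h 1 0
  have h00 : r = u * A 0 0 + v := by simpa using congr_fun₂ h 0 0
  have h11 : r = u * A 1 1 + v := by simpa using congr_fun₂ h 1 1
  have hd : A 1 1 = A 0 0 := mul_left_cancel₀ hu (by linear_combination h00 - h11)
  have hdet := A.det_coe
  rw [det_fin_two, h01, hd] at hdet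
  refine mem_center_iff.mpr ⟨A 0 0, ?_, ?_⟩
  · rw [Fintype.card_fin]
    linear_combination hdet
  · ext i j
    fin_cases i <;> fin_cases j <;> simp [h01, h10, hd]

lemma coe_pow_three_eq (A : SpecialLinearGroup (Fin 2) F) {t : F}
    (ht : trace (A : Matrix (Fin 2) (Fin 2) F) = t) :
    ((A ^ 3 : SpecialLinearGroup (Fin 2) F) : Matrix (Fin 2) (Fin 2) F)
      = (t ^ 2 - 1) • (A : Matrix (Fin 2) (Fin 2) F) + (-t) • 1 := by
  have h := coe_mul_self_eq A
  rw [ht] at h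
  rw [coe_pow, pow_succ, pow_two, h, sub_mul, smul_mul_assoc, h, one_mul]
  module

lemma coe_pow_seven_eq (A : SpecialLinearGroup (Fin 2) F) {t : F}
    (ht : trace (A : Matrix (Fin 2) (Fin 2) F) = t) :
    ((A ^ 7 : SpecialLinearGroup (Fin 2) F) : Matrix (Fin 2) (Fin 2) F)
      = (t ^ 6 - 5 * t ^ 4 + 6 * t ^ 2 - 1) • (A : Matrix (Fin 2) (Fin 2) F)
        + (-(t ^ 5 - 4 * t ^ 3 + 3 * t)) • 1 := by
  have h := coe_mul_self_eq A
  have h3 := coe_pow_three_eq A ht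
  rw [ht] at h
  rw [show A ^ 7 = A ^ 3 * A ^ 3 * A by group, coe_mul, coe_mul, h3]
  simp only [add_mul, mul_add, smul_mul_assoc, mul_smul_comm, h, one_mul, mul_one, sub_mul,
    smul_sub]
  module

lemma trace_pow_two (A : SpecialLinearGroup (Fin 2) F) :
    trace ((A ^ 2 : SpecialLinearGroup (Fin 2) F) : Matrix (Fin 2) (Fin 2) F)
      = trace (A : Matrix (Fin 2) (Fin 2) F) ^ 2 - 2 := by
  rw [coe_pow, pow_two, coe_mul_self_eq, trace_sub, trace_smul, trace_one, smul_eq_mul]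
  simp [pow_two]

lemma trace_pow_three (A : SpecialLinearGroup (Fin 2) F) :
    trace ((A ^ 3 : SpecialLinearGroup (Fin 2) F) : Matrix (Fin 2) (Fin 2) F)
      = trace (A : Matrix (Fin 2) (Fin 2) F) ^ 3 - 3 * trace (A : Matrix (Fin 2) (Fin 2) F) := by
  rw [coe_pow_three_eq A rfl, trace_add, trace_smul, trace_smul, trace_one]
  simp only [smul_eq_mul, Fintype.card_fin, Nat.cast_ofNat]
  ring

/-- A binary quadratic form with nonzero discriminant over a finite field of odd
characteristic represents `1`. -/
lemma _root_.FiniteField.exists_binary_quadratic_eq_one [Fintype F] (h2 : (2 : F) ≠ 0)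
    {a b c : F} (hD : b ^ 2 - 4 * a * c ≠ 0) :
    ∃ x y : F, a * x ^ 2 + b * x * y + c * y ^ 2 = 1 := by
  by_cases ha : a = 0
  · subst ha
    have hb : b ≠ 0 := by
      rintro rfl
      simp at hD
    refine ⟨(1 - c) / b, 1, ?_⟩
    field_simp
    ring
  · obtain ⟨X, Y, h⟩ := FiniteField.exists_root_sum_quadratic (R := F)
      (f := .X ^ 2 - .C (4 * a))
      (g := .C (-(b ^ 2 - 4 * a * c)) * .X ^ 2)
      (Polynomial.degree_X_pow_sub_C (by decide) _)
      (Polynomial.degree_C_mul_X_pow 2 (neg_ne_zero.mpr hD))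
      (FiniteField.odd_card_of_char_ne_two fun h ↦ h2 (by
        have := CharP.cast_eq_zero F (ringChar F)
        rw [h] at this
        exact_mod_cast this))
    simp only [Polynomial.eval_sub, Polynomial.eval_pow, Polynomial.eval_X, Polynomial.eval_C,
      Polynomial.eval_mul] at h
    have h4 : 4 * a ≠ 0 := by
      rw [show (4 : F) = 2 * 2 by norm_num]
      exact mul_ne_zero (mul_ne_zero h2 h2) ha
    refine ⟨(X - b * Y) / (2 * a), Y, mul_left_cancel₀ h4 ?_⟩
    field_simp
    linear_combination 4 * h

/-- Over a finite field of odd characteristic, a matrix of determinant `1` with `tr ^ 2 ≠ 4` is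
conjugate in `SL(2, F)` to the companion matrix of its characteristic polynomial. -/
lemma exists_mul_eq_mul_companion [Fintype F] (h2 : (2 : F) ≠ 0)
    (A : SpecialLinearGroup (Fin 2) F)
    (hA : trace (A : Matrix (Fin 2) (Fin 2) F) ^ 2 ≠ 4) :
    ∃ P : SpecialLinearGroup (Fin 2) F, (A : Matrix (Fin 2) (Fin 2) F) * P
      = P * !![0, -1; 1, trace (A : Matrix (Fin 2) (Fin 2) F)] := by
  have hdet := A.det_coe
  rw [det_fin_two] at hdet
  rw [trace_fin_two] at hA ⊢
  obtain ⟨x, y, hxy⟩ := FiniteField.exists_binary_quadratic_eq_one h2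
    (a := A 1 0) (b := A 1 1 - A 0 0) (c := -A 0 1)
    (fun h ↦ hA (by linear_combination h + 4 * hdet))
  refine ⟨⟨!![x, A 0 0 * x + A 0 1 * y; y, A 1 0 * x + A 1 1 * y], ?_⟩, ?_⟩
  · rw [det_fin_two_of]
    linear_combination hxy
  · ext i j
    fin_cases i <;> fin_cases j <;> simp [mul_apply, Fin.sum_univ_two]
    · linear_combination -x * hdet
    · linear_combination -y * hdet

lemma exists_conj_eq_of_trace_eq [Fintype F] (h2 : (2 : F) ≠ 0)
    {A B : SpecialLinearGroup (Fin 2) F}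
    (hAB : trace (A : Matrix (Fin 2) (Fin 2) F) = trace (B : Matrix (Fin 2) (Fin 2) F))
    (hA : trace (A : Matrix (Fin 2) (Fin 2) F) ^ 2 ≠ 4) :
    ∃ P : SpecialLinearGroup (Fin 2) F, P * A * P⁻¹ = B := by
  obtain ⟨P, hP⟩ := exists_mul_eq_mul_companion h2 A hA
  obtain ⟨Q, hQ⟩ := exists_mul_eq_mul_companion h2 B (hAB ▸ hA)
  let C : SpecialLinearGroup (Fin 2) F :=
    ⟨!![0, -1; 1, trace (A : Matrix (Fin 2) (Fin 2) F)], by simp [det_fin_two_of]⟩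
  have hP' : A * P = P * C := Subtype.ext hP
  have hQ' : B * Q = Q * C := Subtype.ext (by rw [coe_mul, coe_mul, hQ, ← hAB])
  refine ⟨Q * P⁻¹, ?_⟩
  rw [eq_mul_inv_of_mul_eq hP', eq_mul_inv_of_mul_eq hQ']
  group

end Matrix.SpecialLinearGroup

namespace PSL2

open Matrix Matrix.SpecialLinearGroup

variable {F : Type} [Field F]

lemma mk_neg (A : SpecialLinearGroup (Fin 2) F) :
    ((-A : SpecialLinearGroup (Fin 2) F) : PSL2 F) = A := by
  rw [QuotientGroup.eq, mem_center_iff]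
  refine ⟨-1, by simp, ?_⟩
  have : (-A)⁻¹ * A = -1 := by rw [inv_neg, neg_mul, inv_mul_cancel]
  rw [this]
  ext i j
  fin_cases i <;> fin_cases j <;> simp

/-- A subgroup of prime order has a generator that lifts to a non-central matrix. -/
lemma exists_lift_of_card_prime {p : ℕ} [Fact p.Prime] {H : Subgroup (PSL2 F)}
    (hH : Nat.card H = p) :
    ∃ A : SpecialLinearGroup (Fin 2) F, (A : PSL2 F) ∈ H ∧
      A ∉ Subgroup.center (SpecialLinearGroup (Fin 2) F) ∧
      A ^ p ∈ Subgroup.center (SpecialLinearGroup (Fin 2) F) := by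
  have : Finite H := Nat.finite_of_card_ne_zero (hH ▸ (Fact.out : p.Prime).ne_zero)
  have : Nontrivial H :=
    Finite.one_lt_card_iff_nontrivial.mp (hH ▸ (Fact.out : p.Prime).one_lt)
  obtain ⟨⟨x, hx⟩, hx1⟩ := exists_ne (1 : H)
  obtain ⟨A, rfl⟩ := QuotientGroup.mk_surjective x
  refine ⟨A, hx, fun h ↦ hx1 (Subtype.ext ((QuotientGroup.eq_one_iff A).mpr h)), ?_⟩
  rw [← QuotientGroup.eq_one_iff, QuotientGroup.mk_pow]
  exact congrArg Subtype.val (hH ▸ pow_card_eq_one' (x := (⟨_, hx⟩ : H)))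

lemma eq_zpowers_of_sq_trace_ne_four {p : ℕ} [Fact p.Prime] {H : Subgroup (PSL2 F)}
    (hH : Nat.card H = p) {A : SpecialLinearGroup (Fin 2) F} (hAH : (A : PSL2 F) ∈ H)
    (hA : trace (A : Matrix (Fin 2) (Fin 2) F) ^ 2 ≠ 4) :
    Subgroup.zpowers (A : PSL2 F) = H := by
  refine le_antisymm (Subgroup.zpowers_le.mpr hAH) fun y hy ↦ ?_
  have hne : (⟨A, hAH⟩ : H) ≠ 1 := fun h ↦ hA (sq_trace_eq_four_of_mem_center
    ((QuotientGroup.eq_one_iff A).mp (congrArg Subtype.val h)))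
  obtain ⟨k, hk⟩ := mem_zpowers_of_prime_card hH hne (g' := ⟨y, hy⟩)
  exact ⟨k, congrArg Subtype.val hk⟩

lemma exists_map_conj_eq [Fintype F] (h2 : (2 : F) ≠ 0) {p : ℕ} [Fact p.Prime]
    {H K : Subgroup (PSL2 F)} (hH : Nat.card H = p) (hK : Nat.card K = p)
    {A B : SpecialLinearGroup (Fin 2) F} (hAH : (A : PSL2 F) ∈ H) (hBK : (B : PSL2 F) ∈ K)
    (hAB : trace (A : Matrix (Fin 2) (Fin 2) F) = trace (B : Matrix (Fin 2) (Fin 2) F))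
    (hB : trace (B : Matrix (Fin 2) (Fin 2) F) ^ 2 ≠ 4) :
    ∃ g : PSL2 F, Subgroup.map (MulAut.conj g).toMonoidHom H = K := by
  obtain ⟨P, rfl⟩ := exists_conj_eq_of_trace_eq h2 hAB (hAB ▸ hB)
  refine ⟨P, ?_⟩
  rw [← eq_zpowers_of_sq_trace_ne_four hH hAH (hAB ▸ hB),
    ← eq_zpowers_of_sq_trace_ne_four hK hBK hB, MonoidHom.map_zpowers]
  rfl

lemma exists_trace_eq_zero {H : Subgroup (PSL2 F)} (hH : Nat.card H = 2) :
    ∃ A : SpecialLinearGroup (Fin 2) F, (A : PSL2 F) ∈ H ∧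
      trace (A : Matrix (Fin 2) (Fin 2) F) = 0 := by
  obtain ⟨A, hAH, hA, hA2⟩ := exists_lift_of_card_prime hH
  refine ⟨A, hAH, coeff_eq_zero_of_mem_center hA hA2 (v := -1) ?_⟩
  rw [coe_pow, pow_two, coe_mul_self_eq]
  module

lemma exists_trace_eq_neg_one {H : Subgroup (PSL2 F)} (hH : Nat.card H = 3) :
    ∃ A : SpecialLinearGroup (Fin 2) F, (A : PSL2 F) ∈ H ∧
      trace (A : Matrix (Fin 2) (Fin 2) F) = -1 := by
  have : Fact (Nat.Prime 3) := ⟨by norm_num⟩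
  obtain ⟨A, hAH, hA, hA3⟩ := exists_lift_of_card_prime hH
  have h := coeff_eq_zero_of_mem_center hA hA3 (coe_pow_three_eq A rfl)
  rcases sq_eq_sq_iff_eq_or_eq_neg.mp ((sub_eq_zero.mp h).trans (one_pow 2).symm) with h | h
  · exact ⟨-A, by rwa [mk_neg], by rw [coe_neg, trace_neg, h]⟩
  · exact ⟨A, hAH, h⟩

/-- The polynomial `X ^ 3 + X ^ 2 - 2 * X - 1` is the minimal polynomial of `2 * cos (2 * π / 7)`. -/
lemma exists_trace_cubic_eq_zero {H : Subgroup (PSL2 F)} (hH : Nat.card H = 7) :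
    ∃ A : SpecialLinearGroup (Fin 2) F, (A : PSL2 F) ∈ H ∧
      trace (A : Matrix (Fin 2) (Fin 2) F) ^ 3 + trace (A : Matrix (Fin 2) (Fin 2) F) ^ 2
        - 2 * trace (A : Matrix (Fin 2) (Fin 2) F) - 1 = 0 := by
  have : Fact (Nat.Prime 7) := ⟨by norm_num⟩
  obtain ⟨A, hAH, hA, hA7⟩ := exists_lift_of_card_prime hH
  have h := coeff_eq_zero_of_mem_center hA hA7 (coe_pow_seven_eq A rfl)
  set t := trace (A : Matrix (Fin 2) (Fin 2) F) with ht
  have hmul : (t ^ 3 + t ^ 2 - 2 * t - 1) * (t ^ 3 - t ^ 2 - 2 * t + 1) = 0 := by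
    linear_combination h
  rcases mul_eq_zero.mp hmul with h | h
  · exact ⟨A, hAH, h⟩
  · refine ⟨-A, by rwa [mk_neg], ?_⟩
    rw [coe_neg, trace_neg, ← ht]
    linear_combination -h

end PSL2

theorem subgroups_237_conjugate
    (q : ℕ) (hq : IsPrimePow q) (hgcd : Nat.Coprime q 42)
    (hq7 : q % 7 = 1 ∨ q % 7 = 6)
    (F : Type) [Field F] [Fintype F] (hF : Fintype.card F = q)
    (n : ℕ) (hn : n = 2 ∨ n = 3 ∨ n = 7) (H K : Subgroup (PSL2 F))
    (hH : Nat.card H = n) (hK : Nat.card K = n)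
    :
    ∃ g : PSL2 F, Subgroup.map (MulAut.conj g).toMonoidHom H = K := by
  have hne {m : ℕ} (hp : m.Prime) (hm : m ∣ 42) : (m : F) ≠ 0 := by
    have : Fact m.Prime := ⟨hp⟩
    intro h0
    have hchar : ringChar F = m :=
      ((Nat.dvd_prime hp).mp (ringChar.dvd h0)).resolve_left CharP.ringChar_ne_one
    have hdvd : m ∣ q := by
      rw [← hF, ← prime_dvd_char_iff_dvd_card, hchar]
    exact hp.one_lt.ne' (Nat.eq_one_of_dvd_coprimes (hgcd.coprime_dvd_right hm) hdvd dvd_rfl)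
  have h2 : (2 : F) ≠ 0 := mod_cast hne (m := 2) (by norm_num) (by norm_num)
  have h3 : (3 : F) ≠ 0 := mod_cast hne (m := 3) (by norm_num) (by norm_num)
  have h7 : (7 : F) ≠ 0 := mod_cast hne (m := 7) (by norm_num) (by norm_num)
  rcases hn with rfl | rfl | rfl
  · obtain ⟨A, hAH, hA⟩ := PSL2.exists_trace_eq_zero hH
    obtain ⟨B, hBK, hB⟩ := PSL2.exists_trace_eq_zero hK
    refine PSL2.exists_map_conj_eq h2 hH hK hAH hBK (hA.trans hB.symm) fun h ↦ ?_
    rw [hB] at h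
    exact mul_ne_zero h2 h2 (by linear_combination -h)
  · have : Fact (Nat.Prime 3) := ⟨by norm_num⟩
    obtain ⟨A, hAH, hA⟩ := PSL2.exists_trace_eq_neg_one hH
    obtain ⟨B, hBK, hB⟩ := PSL2.exists_trace_eq_neg_one hK
    refine PSL2.exists_map_conj_eq h2 hH hK hAH hBK (hA.trans hB.symm) fun h ↦ ?_
    rw [hB] at h
    exact h3 (by linear_combination -h)
  · have : Fact (Nat.Prime 7) := ⟨by norm_num⟩
    obtain ⟨A, hAH, hA⟩ := PSL2.exists_trace_cubic_eq_zero hH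
    obtain ⟨B, hBK, hB⟩ := PSL2.exists_trace_cubic_eq_zero hK
    have hB4 : Matrix.trace (B : Matrix (Fin 2) (Fin 2) F) ^ 2 ≠ 4 := by
      intro h
      have h' : (Matrix.trace (B : Matrix (Fin 2) (Fin 2) F) - 2)
          * (Matrix.trace (B : Matrix (Fin 2) (Fin 2) F) + 2) = 0 := by linear_combination h
      rcases mul_eq_zero.mp h' with h | h
      · rw [sub_eq_zero.mp h] at hB
        exact h7 (by linear_combination hB)
      · rw [eq_neg_of_add_eq_zero_left h] at hB
        exact one_ne_zero (α := F) (by linear_combination -hB)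
    have hroots : (Matrix.trace (B : Matrix (Fin 2) (Fin 2) F)
          - Matrix.trace (A : Matrix (Fin 2) (Fin 2) F))
        * (Matrix.trace (B : Matrix (Fin 2) (Fin 2) F)
          - (Matrix.trace (A : Matrix (Fin 2) (Fin 2) F) ^ 2 - 2))
        * (Matrix.trace (B : Matrix (Fin 2) (Fin 2) F)
          - (Matrix.trace (A : Matrix (Fin 2) (Fin 2) F) ^ 3
            - 3 * Matrix.trace (A : Matrix (Fin 2) (Fin 2) F))) = 0 := by
      generalize Matrix.trace (A : Matrix (Fin 2) (Fin 2) F) = t at hA ⊢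
      generalize Matrix.trace (B : Matrix (Fin 2) (Fin 2) F) = s at hB ⊢
      linear_combination hB + (-s ^ 2 + (t ^ 2 - 2) * s - (t ^ 3 - t ^ 2 - 2 * t + 1)) * hA
    rcases mul_eq_zero.mp hroots with h | h
    · rcases mul_eq_zero.mp h with h | h
      · exact PSL2.exists_map_conj_eq h2 hH hK hAH hBK (sub_eq_zero.mp h).symm hB4
      · exact PSL2.exists_map_conj_eq h2 hH hK (A := A ^ 2) (H.pow_mem hAH 2) hBK
          (A.trace_pow_two.trans (sub_eq_zero.mp h).symm) hB4
    · exact PSL2.exists_map_conj_eq h2 hH hK (A := A ^ 3) (H.pow_mem hAH 3) hBK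
        (A.trace_pow_three.trans (sub_eq_zero.mp h).symm) hB4
end
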